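/- Let G be a finite abelian group of rank two, G ≅ C_m ⊕ C_{mn} with m ≥ 2, and suppose C_m² has Property B. Then every minimal zero-sum sequence over G of maximal length m + mn − 1 is, for some choice of basis/generating set, either of the form e_j^{ord e_j − 1} ∏_{i=1}^{ord e_k}(−x_i e_j + e_k) with {e₁,e₂} a basis, ord e₂ = mn, {j,k} = {1,2}, x_i ≥ 0, Σ x_i ≡ −1 (mod ord e_j), or of the form g₁^{sm−1} ∏_{i=1}^{(n+1−s)m}(−x_i g₁ + g₂) with s ∈ [1,n], {g₁,g₂} a generating set, ord g₂ = mn, m g₁ = m g₂ if s ≠ 1, x_i ≥ 0, and Σ x_i = m − 1. -/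

import Mathlib

def IsMinZeroSumSeq {G : Type*} [AddCommGroup G] (S : Multiset G) : Prop :=
  S ≠ 0 ∧ S.sum = 0 ∧ ∀ T : Multiset G, T ≤ S → T ≠ 0 → T ≠ S → T.sum ≠ 0

def IsBasisPair {G : Type*} [AddCommGroup G] (e1 e2 : G) : Prop :=
  AddSubgroup.closure {e1, e2} = ⊤ ∧
  ∀ a b : ℤ, a • e1 + b • e2 = 0 → a • e1 = 0 ∧ b • e2 = 0

/-- Property B for `C_m²`: every minimal zero-sum sequence of maximal length `2m - 1`
contains some element with multiplicity `m - 1`. -/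
def PropertyB (m : ℕ) : Prop :=
  ∀ S : Multiset (ZMod m × ZMod m), IsMinZeroSumSeq S → S.card = 2 * m - 1 →
    ∃ g : ZMod m × ZMod m, m - 1 ≤ S.count g


open Finset in
theorem cw_family {ι : Type*} {κ : Type} [Fintype κ] {p : ℕ} [Fact p.Prime] (s : Finset ι)
    (f : κ → ι → ZMod p) (hs : Fintype.card κ * (p - 1) < #s) :
    ∃ t ⊆ s, t.Nonempty ∧ ∀ k, ∑ i ∈ t, f k i = 0 := by
  classical
  have hp : p.Prime := Fact.out
  let P : κ → MvPolynomial s (ZMod p) := fun k => ∑ i : s, f k i • MvPolynomial.X i ^ (p - 1)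
  have hdeg : (∑ k, (P k).totalDegree) < Fintype.card s := by
    rw [Fintype.card_coe]
    refine lt_of_le_of_lt ?_ hs
    calc _ ≤ ∑ k : κ, (p - 1) := by
          refine Finset.sum_le_sum fun k _ => ?_
          apply MvPolynomial.totalDegree_finsetSum_le
          rintro i _
          exact (MvPolynomial.totalDegree_smul_le ..).trans (MvPolynomial.totalDegree_X_pow ..).le
      _ = _ := by simp
  have hdvd := char_dvd_card_solutions_of_fintype_sum_lt p hdeg
  let z : {x : s → ZMod p // ∀ k, MvPolynomial.eval x (P k) = 0} :=
    ⟨0, by intro k; simp [P, map_sum, hp.one_lt, tsub_eq_zero_iff_le]⟩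
  have h0 : 0 < Fintype.card {x : s → ZMod p // ∀ k, MvPolynomial.eval x (P k) = 0} :=
    @Fintype.card_pos _ _ ⟨z⟩
  obtain ⟨x, hx⟩ := Fintype.exists_ne_of_one_lt_card (hp.one_lt.trans_le <|
    Nat.le_of_dvd h0 hdvd) z
  refine ⟨({a | x.1 a ≠ 0} : Finset _).map ⟨(↑), Subtype.val_injective⟩, ?_, ?_, ?_⟩
  · simp +contextual [subset_iff]
  · rw [← Subtype.coe_ne_coe, Function.ne_iff] at hx
    rw [Finset.map_nonempty]
    exact hx.imp (fun a ha ↦ mem_filter.2 ⟨Finset.mem_attach _ _, ha⟩)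
  · intro k
    simpa [P, ZMod.pow_card_sub_one, Finset.sum_filter] using x.2 k

open Finset in
theorem extract_short {ι : Type*} [DecidableEq ι] (Z : Finset ι → Prop) (c m : ℕ)
    (h : ∀ s : Finset ι, c ≤ #s → ∃ t ⊆ s, t.Nonempty ∧ #t ≤ m ∧ Z t) :
    ∀ (k : ℕ) (s : Finset ι), k * m + c ≤ #s + m → ∃ P : Finset (Finset ι), #P = k ∧
      (∀ J ∈ P, J ⊆ s ∧ J.Nonempty ∧ #J ≤ m ∧ Z J) ∧ (P : Set (Finset ι)).PairwiseDisjoint id := by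
  intro k
  induction k with
  | zero => intro s _; exact ⟨∅, by simp⟩
  | succ k ih =>
    intro s hs
    have hs' : k * m + c ≤ #s := by
      have : (k+1) * m = k * m + m := by ring
      omega
    obtain ⟨t, hts, htn, htm, hZ⟩ := h s (by omega)
    have hc := Finset.card_sdiff_of_subset hts
    have hle := Finset.card_le_card hts
    obtain ⟨P, hP, hP1, hP2⟩ := ih (s \ t) (by omega)
    have hnot : t ∉ P := by
      intro ht
      obtain ⟨a, ha⟩ := htn
      have := (hP1 t ht).1 ha
      simp [ha] at this
    refine ⟨insert t P, by rw [card_insert_of_notMem hnot, hP], ?_, ?_⟩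
    · intro J hJ
      rcases mem_insert.1 hJ with rfl | hJ
      · exact ⟨hts, htn, htm, hZ⟩
      · obtain ⟨a, b⟩ := hP1 J hJ
        exact ⟨a.trans sdiff_subset, b⟩
    · rw [coe_insert]
      refine hP2.insert ?_
      intro J hJ _
      have := (hP1 J hJ).1
      exact (disjoint_of_subset_left this sdiff_disjoint).symm

open Finset in
/-- add one more set from the remainder -/
theorem extract_last {ι : Type*} [DecidableEq ι] (Z : Finset ι → Prop) (c d m : ℕ)
    (h : ∀ s : Finset ι, c ≤ #s → ∃ t ⊆ s, t.Nonempty ∧ #t ≤ m ∧ Z t)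
    (h' : ∀ s : Finset ι, d ≤ #s → ∃ t ⊆ s, t.Nonempty ∧ Z t)
    (k : ℕ) (s : Finset ι) (h1 : k * m + c ≤ #s + m) (h2 : k * m + d ≤ #s) :
    ∃ P : Finset (Finset ι), #P = k + 1 ∧
      (∀ J ∈ P, J ⊆ s ∧ J.Nonempty ∧ Z J) ∧ (P : Set (Finset ι)).PairwiseDisjoint id := by
  obtain ⟨P, hP, hP1, hP2⟩ := extract_short Z c m h k s h1
  have hb : #(P.biUnion id) ≤ k * m := by
    rw [← hP]
    exact card_biUnion_le_card_mul _ _ _ fun J hJ => (hP1 J hJ).2.2.1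
  have hbs : P.biUnion id ⊆ s := by
    intro a ha
    obtain ⟨J, hJ, haJ⟩ := mem_biUnion.1 ha
    exact (hP1 J hJ).1 haJ
  have hc := Finset.card_sdiff_of_subset hbs
  obtain ⟨t, hts, htn, hZ⟩ := h' (s \ P.biUnion id) (by omega)
  have hdis : ∀ J ∈ P, Disjoint t J := by
    intro J hJ
    refine disjoint_of_subset_left hts ?_
    refine disjoint_of_subset_right ?_ sdiff_disjoint
    exact subset_biUnion_of_mem id hJ
  have hnot : t ∉ P := by
    intro ht
    have := hdis t ht
    rw [disjoint_self] at this
    exact htn.ne_empty this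
  refine ⟨insert t P, by rw [card_insert_of_notMem hnot, hP], ?_, ?_⟩
  · intro J hJ
    rcases mem_insert.1 hJ with rfl | hJ
    · exact ⟨hts.trans sdiff_subset, htn, hZ⟩
    · obtain ⟨a, b, _, d⟩ := hP1 J hJ
      exact ⟨a, b, d⟩
  · rw [coe_insert]
    exact hP2.insert fun J hJ _ => hdis J hJ

open Finset in
theorem eta_dav_prime {p : ℕ} (hp : p.Prime) {ι : Type*} (f g : ι → ℤ) (s : Finset ι) :
    (2 * p - 1 ≤ #s → ∃ t ⊆ s, t.Nonempty ∧ ((p:ℤ) ∣ ∑ i ∈ t, f i ∧ (p:ℤ) ∣ ∑ i ∈ t, g i)) ∧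
    (3 * p - 2 ≤ #s → ∃ t ⊆ s, t.Nonempty ∧ #t ≤ p ∧
      ((p:ℤ) ∣ ∑ i ∈ t, f i ∧ (p:ℤ) ∣ ∑ i ∈ t, g i)) := by
  classical
  haveI : Fact p.Prime := ⟨hp⟩
  have hp2 := hp.two_le
  have key : ∀ s : Finset ι, 2 * p - 1 ≤ #s →
      ∃ t ⊆ s, t.Nonempty ∧ ((p:ℤ) ∣ ∑ i ∈ t, f i ∧ (p:ℤ) ∣ ∑ i ∈ t, g i) := by
    intro s hs
    obtain ⟨t, ht, htn, hk⟩ := cw_family (κ := Fin 2) (p := p) s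
      ![fun i => (f i : ZMod p), fun i => (g i : ZMod p)] (by simp; omega)
    refine ⟨t, ht, htn, ?_, ?_⟩
    · have := hk 0
      rw [← ZMod.intCast_zmod_eq_zero_iff_dvd]; push_cast; simpa using this
    · have := hk 1
      rw [← ZMod.intCast_zmod_eq_zero_iff_dvd]; push_cast; simpa using this
  refine ⟨key s, fun hs => ?_⟩
  obtain ⟨s', hs's, hs'c⟩ := exists_subset_card_eq hs
  obtain ⟨t, ht, htn, hk⟩ := cw_family (κ := Fin 3) (p := p) s'
      ![fun i => (f i : ZMod p), fun i => (g i : ZMod p), fun i => 1] (by simp; omega)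
  have h1 : (p:ℤ) ∣ ∑ i ∈ t, f i := by
    have := hk 0
    rw [← ZMod.intCast_zmod_eq_zero_iff_dvd]; push_cast; simpa using this
  have h2 : (p:ℤ) ∣ ∑ i ∈ t, g i := by
    have := hk 1
    rw [← ZMod.intCast_zmod_eq_zero_iff_dvd]; push_cast; simpa using this
  have h3 : p ∣ #t := by
    have := hk 2
    rw [← ZMod.natCast_eq_zero_iff]; simpa using this
  have h4 : #t ≤ 3 * p - 2 := hs'c ▸ card_le_card ht
  have h5 := htn.card_pos
  obtain ⟨q, hq⟩ := h3
  have hq3 : q < 3 := by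
    by_contra hcon
    have : p * 3 ≤ p * q := Nat.mul_le_mul_left _ (by omega)
    omega
  interval_cases q
  · omega
  · exact ⟨t, ht.trans hs's, htn, by omega, h1, h2⟩
  · obtain ⟨w, hw, hwn, hw1, hw2⟩ := key (t.erase htn.choose)
      (by rw [card_erase_of_mem htn.choose_spec]; omega)
    have hwt : w ⊆ t := hw.trans (erase_subset _ _)
    have hc := card_sdiff_of_subset hwt
    have hwc : #w ≤ #t - 1 := by
      have := card_le_card hw
      rwa [card_erase_of_mem htn.choose_spec] at this
    by_cases hle : #w ≤ p
    · exact ⟨w, hwt.trans (ht.trans hs's), hwn, hle, hw1, hw2⟩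
    · refine ⟨t \ w, sdiff_subset.trans (ht.trans hs's), ?_, by omega, ?_, ?_⟩
      · rw [← card_pos]; omega
      · have := sum_sdiff (f := f) hwt
        rw [← this] at h1
        exact (Int.dvd_add_left hw1).1 h1
      · have := sum_sdiff (f := g) hwt
        rw [← this] at h2
        exact (Int.dvd_add_left hw2).1 h2

open Finset in
theorem eta_dav (m : ℕ) (hm : 1 ≤ m) {ι : Type*} (f g : ι → ℤ) (s : Finset ι) :
    (2 * m - 1 ≤ #s → ∃ t ⊆ s, t.Nonempty ∧ ((m:ℤ) ∣ ∑ i ∈ t, f i ∧ (m:ℤ) ∣ ∑ i ∈ t, g i)) ∧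
    (3 * m - 2 ≤ #s → ∃ t ⊆ s, t.Nonempty ∧ #t ≤ m ∧
      ((m:ℤ) ∣ ∑ i ∈ t, f i ∧ (m:ℤ) ∣ ∑ i ∈ t, g i)) := by
  classical
  induction m using induction_on_primes generalizing ι with
  | zero => omega
  | one =>
    constructor
    · intro h
      exact ⟨s, subset_rfl, card_pos.1 (by omega), by simp⟩
    · intro h
      obtain ⟨a, ha⟩ := card_pos.1 (show 0 < #s by omega)
      exact ⟨{a}, by simpa using ha, by simp, by simp, by simp⟩
  | prime_mul p q hp ih =>
    have hp2 := hp.two_le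
    have hq : 1 ≤ q := by
      rcases Nat.eq_zero_or_pos q with rfl | h
      · simp at hm
      · exact h
    let Z : Finset ι → Prop := fun t => (p:ℤ) ∣ ∑ i ∈ t, f i ∧ (p:ℤ) ∣ ∑ i ∈ t, g i
    have hD : ∀ s : Finset ι, 2 * p - 1 ≤ #s → ∃ t ⊆ s, t.Nonempty ∧ Z t :=
      fun s => (eta_dav_prime hp f g s).1
    have hE : ∀ s : Finset ι, 3 * p - 2 ≤ #s → ∃ t ⊆ s, t.Nonempty ∧ #t ≤ p ∧ Z t :=
      fun s => (eta_dav_prime hp f g s).2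
    have lift : ∀ (P Q : Finset (Finset ι)), Q ⊆ P → Q.Nonempty →
        (∀ J ∈ P, J ⊆ s ∧ J.Nonempty ∧ Z J) → (P : Set (Finset ι)).PairwiseDisjoint id →
        (q:ℤ) ∣ ∑ J ∈ Q, (∑ i ∈ J, f i) / p → (q:ℤ) ∣ ∑ J ∈ Q, (∑ i ∈ J, g i) / p →
        Q.biUnion id ⊆ s ∧ (Q.biUnion id).Nonempty ∧
          ((p * q : ℕ):ℤ) ∣ ∑ i ∈ Q.biUnion id, f i ∧ ((p * q : ℕ):ℤ) ∣ ∑ i ∈ Q.biUnion id, g i := by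
      intro P Q hQP hQn hP hdis h1 h2
      have hdisQ : (Q : Set (Finset ι)).PairwiseDisjoint id := hdis.subset (by exact_mod_cast hQP)
      refine ⟨?_, ?_, ?_, ?_⟩
      · intro a ha
        obtain ⟨J, hJ, haJ⟩ := mem_biUnion.1 ha
        exact (hP J (hQP hJ)).1 haJ
      · obtain ⟨J, hJ⟩ := hQn
        obtain ⟨a, ha⟩ := (hP J (hQP hJ)).2.1
        exact ⟨a, mem_biUnion.2 ⟨J, hJ, ha⟩⟩
      · rw [sum_biUnion hdisQ]
        have : ∑ J ∈ Q, ∑ i ∈ id J, f i = p * ∑ J ∈ Q, (∑ i ∈ J, f i) / p := by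
          rw [mul_sum]
          refine sum_congr rfl fun J hJ => ?_
          rw [Int.mul_ediv_cancel' (hP J (hQP hJ)).2.2.1]; rfl
        rw [this]; push_cast
        exact mul_dvd_mul_left _ h1
      · rw [sum_biUnion hdisQ]
        have : ∑ J ∈ Q, ∑ i ∈ id J, g i = p * ∑ J ∈ Q, (∑ i ∈ J, g i) / p := by
          rw [mul_sum]
          refine sum_congr rfl fun J hJ => ?_
          rw [Int.mul_ediv_cancel' (hP J (hQP hJ)).2.2.2]; rfl
        rw [this]; push_cast
        exact mul_dvd_mul_left _ h2
    have IH := fun P => ih hq (ι := Finset ι) (fun J => (∑ i ∈ J, f i) / p)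
      (fun J => (∑ i ∈ J, g i) / p) P
    constructor
    · intro hs
      obtain ⟨r, rfl⟩ : ∃ r, q = r + 1 := ⟨q - 1, by omega⟩
      have e1 : p * (r+1) = p * r + p := by ring
      have e2 : (2 * r) * p = 2 * (p * r) := by ring
      obtain ⟨P, hPc, hP1, hP2⟩ := extract_last Z (3 * p - 2) (2 * p - 1) p hE hD (2 * r) s
        (by omega) (by omega)
      obtain ⟨Q, hQP, hQn, h1, h2⟩ := (IH P).1 (by omega)
      obtain ⟨a, b, c, d⟩ := lift P Q hQP hQn hP1 hP2 h1 h2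
      exact ⟨_, a, b, c, d⟩
    · intro hs
      obtain ⟨r, rfl⟩ : ∃ r, q = r + 1 := ⟨q - 1, by omega⟩
      have e1 : p * (r+1) = p * r + p := by ring
      have e2 : (3 * r + 1) * p = 3 * (p * r) + p := by ring
      obtain ⟨P, hPc, hP1, hP2⟩ := extract_short Z (3 * p - 2) p hE (3 * r + 1) s
        (by omega)
      obtain ⟨Q, hQP, hQn, hQc, h1, h2⟩ := (IH P).2 (by omega)
      obtain ⟨a, b, c, d⟩ := lift P Q hQP hQn
        (fun J hJ => ⟨(hP1 J hJ).1, (hP1 J hJ).2.1, (hP1 J hJ).2.2.2⟩) hP2 h1 h2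
      refine ⟨_, a, b, ?_, c, d⟩
      calc #(Q.biUnion id) ≤ #Q * p :=
            card_biUnion_le_card_mul _ _ _ fun J hJ => (hP1 J (hQP hJ)).2.2.1
        _ ≤ (r+1) * p := Nat.mul_le_mul_right _ hQc
        _ = _ := by ring


open Finset in
theorem exists_enum {κ : Type*} [DecidableEq κ] [Nonempty κ] (s : Finset κ) :
    ∃ f : ℕ → κ, (∀ t < #s, f t ∈ s) ∧ Set.InjOn f (range #s : Set ℕ) := by
  classical
  refine ⟨fun t => if h : t < #s then (s.equivFin.symm ⟨t, h⟩ : κ) else Classical.arbitrary κ,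
    ?_, ?_⟩
  · intro t ht
    simp [ht]
  · intro a ha b hb hab
    simp only [coe_range, Set.mem_Iio] at ha hb
    simp only [ha, hb, dite_true] at hab
    have := s.equivFin.symm.injective (Subtype.ext hab)
    simpa using this

open Finset in
theorem zero_sub_of_card {K : Type*} [AddCommGroup K] [Finite K] {κ : Type*} [DecidableEq κ]
    (y : κ → K) (s : Finset κ) (hs : Nat.card K ≤ #s) :
    ∃ t ⊆ s, t.Nonempty ∧ ∑ i ∈ t, y i = 0 := by
  classical
  haveI := Fintype.ofFinite K
  have hpos : 0 < Nat.card K := Nat.card_pos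
  obtain ⟨a, ha⟩ := card_pos.1 (lt_of_lt_of_le hpos hs)
  haveI : Nonempty κ := ⟨a⟩
  obtain ⟨f, hf1, hf2⟩ := exists_enum s
  have : ∃ a b : Fin (#s + 1), a ≠ b ∧
      (∑ t ∈ range a, y (f t)) = ∑ t ∈ range b, y (f t) := by
    obtain ⟨a, b, hab, h⟩ := Fintype.exists_ne_map_eq_of_card_lt
      (fun a : Fin (#s + 1) => ∑ t ∈ range a, y (f t))
      (by rw [← Nat.card_eq_fintype_card, Fintype.card_fin]; omega)
    exact ⟨a, b, hab, h⟩
  obtain ⟨a, b, hab, h⟩ := this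
  wlog hlt : a < b generalizing a b
  · exact this b a hab.symm h.symm (lt_of_le_of_ne (not_lt.1 hlt) hab.symm)
  have hb := b.2
  have hlt' : (a:ℕ) < b := hlt
  have hsub : (Ico (a:ℕ) b : Set ℕ) ⊆ (range #s : Set ℕ) := by
    intro t ht; simp at ht ⊢; omega
  refine ⟨(Ico (a:ℕ) b).image f, ?_, ?_, ?_⟩
  · intro k hk
    obtain ⟨t, ht, rfl⟩ := mem_image.1 hk
    exact hf1 t (by simp at ht; omega)
  · simp [hlt']
  · rw [sum_image (hf2.mono hsub), sum_Ico_eq_sub _ hlt'.le, h, sub_self]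

open Finset in
theorem min_zero_card {K : Type*} [AddCommGroup K] [Finite K] {κ : Type*} [DecidableEq κ]
    (y : κ → K) (s : Finset κ) (hs : #s = Nat.card K) (h0 : ∑ i ∈ s, y i = 0)
    (hmin : ∀ t ⊆ s, t.Nonempty → t ≠ s → ∑ i ∈ t, y i ≠ 0) :
    (∀ i ∈ s, ∀ j ∈ s, y i = y j) ∧ ∀ i ∈ s, addOrderOf (y i) = Nat.card K := by
  classical
  haveI := Fintype.ofFinite K
  have hpos : 0 < Nat.card K := Nat.card_pos
  have heq : ∀ i ∈ s, ∀ j ∈ s, y i = y j := by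
    intro i hi j hj
    by_cases hij : i = j
    · rw [hij]
    haveI : Nonempty κ := ⟨i⟩
    obtain ⟨f', hf'1, hf'2⟩ := exists_enum ((s.erase i).erase j)
    have hc1 : #(s.erase i) = #s - 1 := card_erase_of_mem hi
    have hc2 : #((s.erase i).erase j) = #s - 1 - 1 := by
      rw [card_erase_of_mem (by simp [hj, Ne.symm hij]), hc1]
    have h2 : 2 ≤ #s := by
      have : ({i, j} : Finset κ) ⊆ s := by
        intro k hk; simp at hk; rcases hk with rfl | rfl <;> assumption
      have := card_le_card this
      rwa [card_pair hij] at this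
    let f : ℕ → κ := fun t => match t with
      | 0 => i
      | 1 => j
      | t + 2 => f' t
    have hf1 : ∀ t < #s, f t ∈ s := by
      intro t ht
      match t, ht with
      | 0, _ => exact hi
      | 1, _ => exact hj
      | t + 2, ht =>
        have := hf'1 t (by omega)
        simp at this
        exact this.2.2
    have hf2 : Set.InjOn f (range #s : Set ℕ) := by
      intro a ha b hb hab
      simp only [coe_range, Set.mem_Iio] at ha hb
      have hno : ∀ t, t + 2 < #s → f' t ≠ i ∧ f' t ≠ j := by
        intro t ht
        have := hf'1 t (by omega)
        simp at this
        exact ⟨this.2.1, this.1⟩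
      match a, b, ha, hb, hab with
      | 0, 0, _, _, _ => rfl
      | 0, 1, _, _, h => exact absurd h hij
      | 1, 0, _, _, h => exact absurd h.symm hij
      | 1, 1, _, _, _ => rfl
      | 0, b + 2, _, hb, h => exact absurd h.symm (hno b hb).1
      | 1, b + 2, _, hb, h => exact absurd h.symm (hno b hb).2
      | b + 2, 0, hb, _, h => exact absurd h (hno b hb).1
      | b + 2, 1, hb, _, h => exact absurd h (hno b hb).2
      | a + 2, b + 2, ha, hb, h =>
        have := hf'2 (by simp; omega) (by simp; omega) h
        omega
    have key : ∀ t ⊆ range #s, t.Nonempty → #t < #s → ∑ k ∈ t, y (f k) ≠ 0 := by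
      intro t ht htn htc
      have hinj : Set.InjOn f (t : Set ℕ) := hf2.mono (by exact_mod_cast ht)
      rw [← sum_image (f := y) hinj]
      refine hmin _ ?_ (by simpa using htn) ?_
      · intro k hk
        obtain ⟨a, ha, rfl⟩ := mem_image.1 hk
        exact hf1 a (by simpa using ht ha)
      · intro h
        have := card_image_of_injOn hinj
        rw [h] at this
        omega
    obtain ⟨a, b, hab, h⟩ := Fintype.exists_ne_map_eq_of_card_lt
      (fun a : Fin (#s + 1) => if (a : ℕ) < #s then ∑ t ∈ range a, y (f t) else y j)
      (by rw [← Nat.card_eq_fintype_card, Fintype.card_fin]; omega)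
    wlog hlt : a < b generalizing a b
    · exact this b a hab.symm h.symm (lt_of_le_of_ne (not_lt.1 hlt) hab.symm)
    have hlt' : (a:ℕ) < b := hlt
    have hb := b.2
    have ha : (a:ℕ) < #s := by omega
    simp only [ha, if_true] at h
    by_cases hbs : (b:ℕ) < #s
    · simp only [hbs, if_true] at h
      exfalso
      refine key (Ico (a:ℕ) b) ?_ (by simp [hlt']) (by simp; omega) ?_
      · intro t ht; simp at ht ⊢; omega
      · rw [sum_Ico_eq_sub _ hlt'.le, h, sub_self]
    · simp only [hbs, if_false] at h
      generalize (a:ℕ) = a' at *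
      match a' with
      | 0 =>
        exfalso
        refine key {1} (by simp; omega) (by simp) (by simp; omega) ?_
        simp [f]; simpa using h.symm
      | 1 => simpa [f] using h
      | a' + 2 =>
        exfalso
        refine key ((range (a'+2)).erase 1) ?_ ⟨0, by simp⟩ ?_ ?_
        · intro t ht; simp at ht ⊢; omega
        · rw [card_erase_of_mem (by simp)]; simp; omega
        · rw [sum_erase_eq_sub (by simp), h]; simp [f]
  refine ⟨heq, fun i hi => ?_⟩
  have hconst : ∀ t ⊆ s, ∑ k ∈ t, y k = #t • y i := by
    intro t ht
    exact sum_eq_card_nsmul fun k hk => heq k (ht hk) i hi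
  rw [addOrderOf_eq_iff hpos]
  refine ⟨by rw [← hs, ← hconst s subset_rfl, h0], fun k hk hk0 hz => ?_⟩
  obtain ⟨t, ht, htc⟩ := exists_subset_card_eq (show k ≤ #s by omega)
  refine hmin t ht (card_pos.1 (by omega)) ?_ ?_
  · rintro rfl; omega
  · rw [hconst t ht, htc, hz]

open Finset in
/-- If a minimal zero-sum sequence contains an element `h` exactly `ord h - 1` times and the
remaining part is as long as the index of `⟨h⟩`, the rest is constant modulo `⟨h⟩`. -/
theorem quot_lemma {A : Type*} [AddCommGroup A] [Finite A] {ι : Type*} [DecidableEq ι]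
    (x : ι → A) (U F : Finset ι) (hFU : F ⊆ U) (h : A) (hF : ∀ i ∈ F, x i = h)
    (hFc : #F = addOrderOf h - 1) (L : ℕ) (hL : #(U \ F) = L)
    (hcard : Nat.card A = addOrderOf h * L) (h0 : ∑ i ∈ U, x i = 0)
    (hmin : ∀ t ⊆ U, t.Nonempty → t ≠ U → ∑ i ∈ t, x i ≠ 0) :
    (∀ i ∈ U \ F, ∀ j ∈ U \ F, x i - x j ∈ AddSubgroup.zmultiples h) ∧
    ∀ i ∈ U \ F, ∀ k : ℤ, k • x i ∈ AddSubgroup.zmultiples h ↔ (L : ℤ) ∣ k := by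
  classical
  have hord : 0 < addOrderOf h := addOrderOf_pos h
  let N := AddSubgroup.zmultiples h
  have hq : Nat.card (A ⧸ N) = L := by
    have := AddSubgroup.card_eq_card_quotient_mul_card_addSubgroup N
    rw [Nat.card_zmultiples, hcard, mul_comm] at this
    exact (Nat.eq_of_mul_eq_mul_right hord this).symm
  let y : ι → A ⧸ N := fun i => QuotientAddGroup.mk' N (x i)
  have hsum : ∀ t : Finset ι, ∑ i ∈ t, y i = QuotientAddGroup.mk' N (∑ i ∈ t, x i) := by
    intro t; simp [y, map_sum]
  have hz : ∑ i ∈ U \ F, y i = 0 := by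
    rw [hsum]
    have h1 := sum_sdiff (f := x) hFU
    rw [h0, sum_eq_card_nsmul hF] at h1
    have h2 : ∑ i ∈ U \ F, x i = -(#F • h) := eq_neg_of_add_eq_zero_left h1
    rw [h2, QuotientAddGroup.mk'_apply, QuotientAddGroup.eq_zero_iff]
    exact N.neg_mem (N.nsmul_mem (AddSubgroup.mem_zmultiples h) _)
  have hm : ∀ t ⊆ U \ F, t.Nonempty → t ≠ U \ F → ∑ i ∈ t, y i ≠ 0 := by
    intro t ht htn htne hzero
    rw [hsum, QuotientAddGroup.mk'_apply, QuotientAddGroup.eq_zero_iff] at hzero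
    have hneg := N.neg_mem hzero
    rw [← mem_multiples_iff_mem_zmultiples, mem_multiples_iff_mem_range_addOrderOf] at hneg
    obtain ⟨k, hk, hkeq⟩ := mem_image.1 hneg
    rw [mem_range] at hk
    obtain ⟨F', hF', hF'c⟩ := exists_subset_card_eq (show k ≤ #F by omega)
    have hdis : Disjoint t F' :=
      disjoint_of_subset_left ht (disjoint_of_subset_right hF' sdiff_disjoint)
    refine hmin (t ∪ F') (union_subset (ht.trans sdiff_subset) (hF'.trans hFU))
      (htn.mono subset_union_left) ?_ ?_
    · intro hU
      apply htne
      refine Subset.antisymm ht ?_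
      intro a ha
      have : a ∈ t ∪ F' := hU ▸ (mem_sdiff.1 ha).1
      rcases mem_union.1 this with h | h
      · exact h
      · exact absurd (hF' h) (mem_sdiff.1 ha).2
    · rw [sum_union hdis, sum_eq_card_nsmul (fun i hi => hF i (hF' hi)), hF'c]
      have hkeq : k • h = _ := hkeq
      rw [hkeq]; simp
  obtain ⟨h1, h2⟩ := min_zero_card y (U \ F) (by rw [hL, hq]) hz hm
  constructor
  · intro i hi j hj
    have := h1 i hi j hj
    simp only [y, QuotientAddGroup.mk'_apply] at this
    rw [← QuotientAddGroup.eq_zero_iff, QuotientAddGroup.mk_sub, this, sub_self]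
  · intro i hi k
    have := h2 i hi
    rw [hq] at this
    rw [← this, addOrderOf_dvd_iff_zsmul_eq_zero, ← QuotientAddGroup.eq_zero_iff]
    rfl


/-- The standing data: a minimal zero-sum family of maximal length. -/
structure Ctx {G ι : Type*} [AddCommGroup G] [Fintype ι] [DecidableEq ι]
    (m n : ℕ) (x : ι → G) (H : AddSubgroup G) : Prop where
  hm : 2 ≤ m
  hn : 1 ≤ n
  card : Fintype.card ι = m + m * n - 1
  sum0 : ∑ i, x i = 0
  min : ∀ J : Finset ι, J.Nonempty → J ≠ Finset.univ → ∑ i ∈ J, x i ≠ 0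
  hH : Nat.card H = n
  hG : Nat.card G = m * m * n
  hexp : ∀ g : G, (m * n) • g = 0
  hfr : ∃ u v : G →+ ZMod m, ∀ g, g ∈ H ↔ u g = 0 ∧ v g = 0

def ZFam {G ι : Type*} [AddCommGroup G] (x : ι → G) (H : AddSubgroup G)
    (s : Finset ι) (P : Finset (Finset ι)) : Prop :=
  (∀ J ∈ P, J ⊆ s ∧ J.Nonempty ∧ ∑ i ∈ J, x i ∈ H) ∧
    (P : Set (Finset ι)).PairwiseDisjoint id

def Good {G ι : Type*} [AddCommGroup G] [Fintype ι] [DecidableEq ι] (n : ℕ)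
    (x : ι → G) (H : AddSubgroup G) (K : Finset ι) : Prop :=
  ∃ P, P.card = n - 2 ∧ ZFam x H Kᶜ P

section
variable {G ι : Type*} [AddCommGroup G] [Fintype ι] [DecidableEq ι]
  {m n : ℕ} {x : ι → G} {H : AddSubgroup G}

open Finset in
theorem Ctx.sub (c : Ctx m n x H) (s : Finset ι) :
    (2*m-1 ≤ #s → ∃ t ⊆ s, t.Nonempty ∧ ∑ i ∈ t, x i ∈ H) ∧
    (3*m-2 ≤ #s → ∃ t ⊆ s, t.Nonempty ∧ #t ≤ m ∧ ∑ i ∈ t, x i ∈ H) := by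
  obtain ⟨u, v, huv⟩ := c.hfr
  have hm := c.hm
  have : NeZero m := ⟨by omega⟩
  have key : ∀ (w : G →+ ZMod m) (t : Finset ι),
      (m:ℤ) ∣ ∑ i ∈ t, ((w (x i)).val : ℤ) → w (∑ i ∈ t, x i) = 0 := by
    intro w t h
    have := (ZMod.intCast_zmod_eq_zero_iff_dvd _ m).2 h
    push_cast at this
    simp only [ZMod.natCast_val, ZMod.cast_id', id] at this
    rw [map_sum]; exact this
  have := eta_dav m (by omega) (fun i => ((u (x i)).val : ℤ)) (fun i => ((v (x i)).val : ℤ)) s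
  constructor
  · intro h
    obtain ⟨t, h1, h2, h3, h4⟩ := this.1 h
    exact ⟨t, h1, h2, (huv _).2 ⟨key u t h3, key v t h4⟩⟩
  · intro h
    obtain ⟨t, h1, h2, h5, h3, h4⟩ := this.2 h
    exact ⟨t, h1, h2, h5, (huv _).2 ⟨key u t h3, key v t h4⟩⟩

open Finset in
theorem Ctx.zfam (c : Ctx m n x H) (k : ℕ) (s : Finset ι) (hs : (k+1)*m-1 ≤ #s) :
    ∃ P, #P = k ∧ ZFam x H s P := by
  have hm := c.hm
  rcases k with _ | k
  · exact ⟨∅, by simp, by simp [ZFam]⟩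
  · obtain ⟨P, h1, h2, h3⟩ := extract_last (fun t : Finset ι => ∑ i ∈ t, x i ∈ H) (3*m-2) (2*m-1) m
      (fun s h => (c.sub s).2 h) (fun s h => (c.sub s).1 h) k s
      (by have : (k+1+1)*m = k*m+2*m := by ring
          omega)
      (by have : (k+1+1)*m = k*m+2*m := by ring
          omega)
    exact ⟨P, h1, h2, h3⟩

open Finset in
theorem Ctx.zfam_short (c : Ctx m n x H) (k : ℕ) (s : Finset ι) (hs : k*m+2*m-2 ≤ #s) :
    ∃ P, #P = k ∧ ZFam x H s P ∧ ∀ J ∈ P, #J ≤ m := by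
  have hm := c.hm
  obtain ⟨P, h1, h2, h3⟩ := extract_short (fun t : Finset ι => ∑ i ∈ t, x i ∈ H) (3*m-2) m
      (fun s h => (c.sub s).2 h) k s (by omega)
  exact ⟨P, h1, ⟨fun J hJ => ⟨(h2 J hJ).1, (h2 J hJ).2.1, (h2 J hJ).2.2.2⟩, h3⟩,
    fun J hJ => (h2 J hJ).2.2.1⟩

open Finset in
theorem ZFam.insert {s : Finset ι} {P : Finset (Finset ι)} (h : ZFam x H s P) {J : Finset ι}
    (hJ : J.Nonempty) (hJs : J ⊆ s) (hz : ∑ i ∈ J, x i ∈ H) (hd : ∀ T ∈ P, Disjoint J T) :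
    J ∉ P ∧ ZFam x H s (Insert.insert J P) := by
  constructor
  · intro hJP
    obtain ⟨i, hi⟩ := hJ
    exact disjoint_left.1 (hd J hJP) hi hi
  · constructor
    · intro T hT
      rcases mem_insert.1 hT with rfl | hT
      · exact ⟨hJs, hJ, hz⟩
      · exact h.1 T hT
    · rw [coe_insert]
      exact h.2.insert (fun T hT _ => hd T hT)

open Finset in
theorem ZFam.mono {s s' : Finset ι} {P : Finset (Finset ι)} (h : ZFam x H s P) (hs : s ⊆ s') :
    ZFam x H s' P :=
  ⟨fun J hJ => ⟨(h.1 J hJ).1.trans hs, (h.1 J hJ).2⟩, h.2⟩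

open Finset in
theorem ZFam.sub {s : Finset ι} {P Q : Finset (Finset ι)} (h : ZFam x H s P) (hs : Q ⊆ P) :
    ZFam x H s Q :=
  ⟨fun J hJ => h.1 J (hs hJ), h.2.subset (by exact_mod_cast hs)⟩

open Finset in
theorem Ctx.cover (c : Ctx m n x H) {P t : Finset (Finset ι)} (hP : ZFam x H univ P)
    (ht : t ⊆ P) (hne : t.Nonempty) (h0 : ∑ J ∈ t, ∑ i ∈ J, x i = 0) :
    t = P ∧ P.biUnion id = univ := by
  have h1 : t.biUnion id = univ := by
    by_contra hcon
    refine c.min _ ?_ hcon ?_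
    · obtain ⟨J, hJ⟩ := hne
      obtain ⟨i, hi⟩ := (hP.1 J (ht hJ)).2.1
      exact ⟨i, mem_biUnion.2 ⟨J, hJ, hi⟩⟩
    · rw [sum_biUnion (hP.sub ht).2]; exact h0
  have h2 : t = P := by
    refine Subset.antisymm ht ?_
    intro J hJ
    obtain ⟨i, hi⟩ := (hP.1 J hJ).2.1
    have : i ∈ t.biUnion id := h1 ▸ mem_univ i
    obtain ⟨T, hT, hiT⟩ := mem_biUnion.1 this
    by_contra hJt
    have hne : J ≠ T := fun h => hJt (h ▸ hT)
    exact disjoint_left.1 (hP.2 hJ (ht hT) hne) hi hiT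
  exact ⟨h2, h2 ▸ h1⟩

open Finset in
theorem Ctx.famcard (c : Ctx m n x H) {P : Finset (Finset ι)} (hP : ZFam x H univ P) :
    #P ≤ n ∧ (#P = n → P.biUnion id = univ ∧ ∃ e, addOrderOf e = n ∧ ∀ J ∈ P, ∑ i ∈ J, x i = e) := by
  classical
  have hn := c.hn
  have : Finite H := Nat.finite_of_card_ne_zero (by rw [c.hH]; omega)
  let y : Finset ι → H := fun J => if h : ∑ i ∈ J, x i ∈ H then ⟨_, h⟩ else 0
  have hy : ∀ J ∈ P, (y J : G) = ∑ i ∈ J, x i := by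
    intro J hJ
    simp only [y, dif_pos (hP.1 J hJ).2.2]
  have hy' : ∀ t ⊆ P, ((∑ J ∈ t, y J : H) : G) = ∑ J ∈ t, ∑ i ∈ J, x i := by
    intro t ht
    rw [AddSubgroup.val_finsetSum]
    exact sum_congr rfl (fun J hJ => hy J (ht hJ))
  have key : ∀ t ⊆ P, t.Nonempty → ∑ J ∈ t, y J = 0 → t = P ∧ P.biUnion id = univ := by
    intro t ht hne h0
    exact c.cover hP ht hne (by rw [← hy' t ht, h0]; rfl)
  have h1 : #P ≤ n := by
    by_contra hcon
    obtain ⟨s, hs, hsc⟩ := exists_subset_card_eq (show n ≤ #P by omega)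
    obtain ⟨t, ht, hne, h0⟩ := zero_sub_of_card y s (by rw [c.hH, hsc])
    have := (key t (ht.trans hs) hne h0).1
    have := card_le_card ht
    subst t; omega
  refine ⟨h1, fun hPn => ?_⟩
  obtain ⟨t, ht, hne, h0⟩ := zero_sub_of_card y P (by rw [c.hH, hPn])
  obtain ⟨rfl, hc⟩ := key t ht hne h0
  refine ⟨hc, ?_⟩
  obtain ⟨ha, hb⟩ := min_zero_card y t (by rw [c.hH, hPn]) h0
    (fun s hs hne hst h0 => hst (key s hs hne h0).1)
  obtain ⟨J, hJ⟩ := hne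
  refine ⟨y J, ?_, fun J' hJ' => ?_⟩
  · have := hb J hJ
    rw [c.hH] at this
    rw [← this]
    exact AddSubgroup.addOrderOf_coe (y J)
  · rw [← hy J' hJ', ha J' hJ' J hJ]

open Finset in
theorem Ctx.le_card (c : Ctx m n x H) {J : Finset ι} (hJ : J.Nonempty) (hz : ∑ i ∈ J, x i ∈ H) :
    m ≤ #J := by
  by_contra hcon
  have hn := c.hn
  have h1 : #Jᶜ = m + m*n - 1 - #J := by rw [card_compl, c.card]
  have hmn : m * 1 ≤ m * n := Nat.mul_le_mul_left _ hn
  have hm := c.hm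
  obtain ⟨a, ha⟩ := card_pos.1 (show 0 < #Jᶜ by omega)
  obtain ⟨P, hP, hz'⟩ := c.zfam (n-1) (Jᶜ.erase a) (by
    rw [card_erase_of_mem ha, Nat.sub_add_cancel hn, mul_comm n m]; omega)
  have hd : ∀ T ∈ P, Disjoint J T := by
    intro T hT
    rw [disjoint_left]
    intro i hi hiT
    have := (hz'.1 T hT).1 hiT
    simp at this
    exact this.2 hi
  obtain ⟨hnot, hfam⟩ := (hz'.mono (subset_univ _)).insert hJ (subset_univ _) hz hd
  obtain ⟨hcov, -⟩ := (c.famcard hfam).2 (by rw [card_insert_of_notMem hnot, hP]; omega)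
  have : a ∈ (insert J P).biUnion id := hcov ▸ mem_univ a
  obtain ⟨T, hT, haT⟩ := mem_biUnion.1 this
  rcases mem_insert.1 hT with rfl | hT
  · exact (mem_compl.1 ha) haT
  · have := (hz'.1 T hT).1 haT
    simp at this

open Finset in
theorem Ctx.good_sum (c : Ctx m n x H) (hn : 2 ≤ n) {K : Finset ι} (hK : Good n x H K)
    {J : Finset ι} (hJ : J.Nonempty) (hJK : J ⊂ K) (hJz : ∑ i ∈ J, x i ∈ H) :
    addOrderOf (∑ i ∈ J, x i) = n ∧ ∀ J' : Finset ι, J'.Nonempty → J' ⊂ K → ∑ i ∈ J', x i ∈ H →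
      ∑ i ∈ J', x i = ∑ i ∈ J, x i := by
  obtain ⟨P, hPc, hP⟩ := hK
  -- general fact
  have gen : ∀ J : Finset ι, J.Nonempty → J ⊂ K → ∑ i ∈ J, x i ∈ H →
      addOrderOf (∑ i ∈ J, x i) = n ∧ ∀ T ∈ P, ∑ i ∈ T, x i = ∑ i ∈ J, x i := by
    intro J hJ hJK hJz
    have hd : ∀ T ∈ P, Disjoint J T := by
      intro T hT
      rw [disjoint_left]
      intro i hi hiT
      exact mem_compl.1 ((hP.1 T hT).1 hiT) (hJK.1 hi)
    obtain ⟨hnot, hfam⟩ := (hP.mono (subset_univ _)).insert hJ (subset_univ _) hJz hd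
    let R : Finset ι := ((insert J P).biUnion id)ᶜ
    have hR : R.Nonempty := by
      obtain ⟨a, haK, haJ⟩ := exists_of_ssubset hJK
      refine ⟨a, mem_compl.2 fun h => ?_⟩
      obtain ⟨T, hT, haT⟩ := mem_biUnion.1 h
      rcases mem_insert.1 hT with rfl | hT
      · exact haJ haT
      · exact mem_compl.1 ((hP.1 T hT).1 haT) haK
    have hRz : ∑ i ∈ R, x i ∈ H := by
      have h1 := sum_add_sum_compl ((insert J P).biUnion id) x
      rw [c.sum0, sum_biUnion hfam.2] at h1
      rw [show ∑ i ∈ R, x i = -(∑ T ∈ insert J P, ∑ i ∈ T, x i) from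
        (neg_eq_of_add_eq_zero_right h1).symm]
      exact H.neg_mem (H.sum_mem fun T hT => (hfam.1 T hT).2.2)
    obtain ⟨hnot2, hfam2⟩ := hfam.insert hR (subset_univ _) hRz (by
      intro T hT
      rw [disjoint_left]
      intro i hi hiT
      exact mem_compl.1 hi (mem_biUnion.2 ⟨T, hT, hiT⟩))
    obtain ⟨-, e, he, hall⟩ := (c.famcard hfam2).2 (by
      rw [card_insert_of_notMem hnot2, card_insert_of_notMem hnot, hPc]; omega)
    have hJe := hall J (by simp)
    refine ⟨by rw [hJe, he], fun T hT => ?_⟩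
    rw [hJe, hall T (by simp [hT])]
  refine ⟨(gen J hJ hJK hJz).1, fun J' hJ' hJK' hJz' => ?_⟩
  by_cases hn2 : n = 2
  · have hc : Nat.card H = 2 := by rw [c.hH, hn2]
    have h1 := gen J hJ hJK hJz
    have h2 := gen J' hJ' hJK' hJz'
    have hne1 : ∑ i ∈ J, x i ≠ 0 := by
      intro h; rw [h, addOrderOf_zero] at h1; omega
    have hne2 : ∑ i ∈ J', x i ≠ 0 := by
      intro h; rw [h, addOrderOf_zero] at h2; omega
    obtain ⟨a, b, hab, huniv⟩ := Nat.card_eq_two_iff.1 hc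
    have hz : (0 : H) ∈ ({a, b} : Set H) := huniv ▸ Set.mem_univ _
    have hj : (⟨_, hJz⟩ : H) ∈ ({a, b} : Set H) := huniv ▸ Set.mem_univ _
    have hj' : (⟨_, hJz'⟩ : H) ∈ ({a, b} : Set H) := huniv ▸ Set.mem_univ _
    have e1 : (⟨_, hJz⟩ : H) ≠ 0 := fun h => hne1 (congrArg Subtype.val h)
    have e2 : (⟨_, hJz'⟩ : H) ≠ 0 := fun h => hne2 (congrArg Subtype.val h)
    have : (⟨_, hJz'⟩ : H) = ⟨_, hJz⟩ := by
      simp only [Set.mem_insert_iff, Set.mem_singleton_iff] at hz hj hj'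
      grind
    exact congrArg Subtype.val this
  · obtain ⟨T, hT⟩ := card_pos.1 (show 0 < #P by omega)
    rw [← (gen J hJ hJK hJz).2 T hT, ← (gen J' hJ' hJK' hJz').2 T hT]

open Finset in
theorem Ctx.good_of_card (c : Ctx m n x H) (hn : 2 ≤ n) {K : Finset ι} (hK : #K ≤ 2 * m) :
    Good n x H K := by
  obtain ⟨P, h1, h2⟩ := c.zfam (n-2) Kᶜ (by
    rw [card_compl, c.card]
    obtain ⟨k, rfl⟩ := Nat.exists_eq_add_of_le hn
    have : m * (2 + k) = (k+1)*m+m := by ring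
    simp only [Nat.add_sub_cancel_left]
    omega)
  exact ⟨P, h1, h2⟩

open Finset in
theorem Ctx.decomp (c : Ctx m n x H) : ∃ P : Finset (Finset ι), ∃ U : Finset ι,
    ZFam x H univ P ∧ U = (P.biUnion id)ᶜ ∧ (∀ T ∈ P, #T = m) ∧ #P = n - 1 ∧ #U = 2 * m - 1 ∧
    (∑ i ∈ U, x i ∈ H) ∧ (∀ J ⊆ U, J.Nonempty → J ≠ U → ∑ i ∈ J, x i ∉ H) ∧
    (2 ≤ n → ∀ T ∈ P, Good n x H (T ∪ U)) := by
  have hn := c.hn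
  have hm := c.hm
  obtain ⟨k, rfl⟩ := Nat.exists_eq_add_of_le hn
  have hcard : #(univ : Finset ι) = k * m + (2 * m - 1) := by
    rw [card_univ, c.card]
    have : m * (1 + k) = k*m+m := by ring
    omega
  obtain ⟨P, h1, h2, h3⟩ := c.zfam_short k univ (by omega)
  have hT : ∀ T ∈ P, #T = m := fun T hT =>
    le_antisymm (h3 T hT) (c.le_card (h2.1 T hT).2.1 (h2.1 T hT).2.2)
  have hcU : #(P.biUnion id) = k * m := by
    rw [card_biUnion h2.2, sum_const_nat (m := m) (f := fun T => #(id T)) (fun T hT1 => hT T hT1), h1]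
  have hdis : ∀ J ⊆ (P.biUnion id)ᶜ, ∀ T ∈ P, Disjoint J T := by
    intro J hJ T hT
    rw [disjoint_left]
    intro i hi hiT
    exact mem_compl.1 (hJ hi) (mem_biUnion.2 ⟨T, hT, hiT⟩)
  refine ⟨P, _, h2, rfl, hT, by omega, ?_, ?_, ?_, ?_⟩
  · rw [card_compl, hcU, ← card_univ, hcard]; omega
  · have h1 := sum_add_sum_compl (P.biUnion id) x
    rw [c.sum0, sum_biUnion h2.2] at h1
    rw [(neg_eq_of_add_eq_zero_right h1).symm]
    exact H.neg_mem (H.sum_mem fun T hT => (h2.1 T hT).2.2)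
  · intro J hJ hne hJU hz
    obtain ⟨hnot, hfam⟩ := h2.insert hne (subset_univ _) hz (hdis J hJ)
    obtain ⟨hcov, -⟩ := (c.famcard hfam).2 (by rw [card_insert_of_notMem hnot, h1]; omega)
    obtain ⟨a, haK, haJ⟩ := exists_of_ssubset (lt_of_le_of_ne hJ hJU)
    have : a ∈ (insert J P).biUnion id := hcov ▸ mem_univ a
    rw [biUnion_insert] at this
    rcases mem_union.1 this with h | h
    · exact haJ h
    · exact mem_compl.1 haK h
  · intro hn2 T hTP
    refine ⟨P.erase T, by rw [card_erase_of_mem hTP]; omega, ?_⟩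
    have := h2.sub (erase_subset T P)
    refine ⟨fun J hJ => ⟨?_, (this.1 J hJ).2⟩, this.2⟩
    intro i hi
    rw [mem_compl, mem_union]
    rintro (h | h)
    · exact disjoint_left.1 (h2.2 (mem_of_mem_erase hJ) hTP (ne_of_mem_erase hJ)) hi h
    · exact mem_compl.1 h (mem_biUnion.2 ⟨J, mem_of_mem_erase hJ, hi⟩)

end


open Finset in
theorem swap_const {α β : Type*} [DecidableEq α] (B : Finset α) (r : ℕ) (f : Finset α → β)
    (h : ∀ I ⊆ B, #I = r → ∀ i ∈ I, ∀ j ∈ B, j ∉ I → f (insert j (I.erase i)) = f I) :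
    ∀ I ⊆ B, #I = r → ∀ I' ⊆ B, #I' = r → f I = f I' := by
  suffices H : ∀ d : ℕ, ∀ I ⊆ B, #I = r → ∀ I' ⊆ B, #I' = r → #(I \ I') = d → f I = f I' from
    fun I hI hc I' hI' hc' => H _ I hI hc I' hI' hc' rfl
  intro d
  induction d with
  | zero =>
    intro I hI hc I' hI' hc' hd
    rw [card_eq_zero, sdiff_eq_empty_iff_subset] at hd
    rw [eq_of_subset_of_card_le hd (by omega)]
  | succ d ih =>
    intro I hI hc I' hI' hc' hd
    obtain ⟨i, hi⟩ := card_pos.1 (show 0 < #(I \ I') by omega)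
    have hd' : #(I' \ I) = d + 1 := by
      have h1 := card_sdiff_add_card_inter I I'
      have h2 := card_sdiff_add_card_inter I' I
      rw [inter_comm] at h2
      omega
    obtain ⟨j, hj⟩ := card_pos.1 (show 0 < #(I' \ I) by omega)
    rw [mem_sdiff] at hi hj
    rw [← h I hI hc i hi.1 j (hI' hj.1) hj.2]
    apply ih _ _ _ I' hI' hc'
    · have : insert j (I.erase i) \ I' = (I \ I').erase i := by
        ext a
        simp only [mem_sdiff, mem_insert, mem_erase]
        constructor
        · rintro ⟨rfl | h, h2⟩
          · exact absurd hj.1 h2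
          · exact ⟨h.1, h.2, h2⟩
        · rintro ⟨h1, h2, h3⟩
          exact ⟨Or.inr ⟨h1, h2⟩, h3⟩
      rw [this, card_erase_of_mem (mem_sdiff.2 hi)]; omega
    · intro a ha
      rcases mem_insert.1 ha with rfl | ha
      · exact hI' hj.1
      · exact hI (mem_of_mem_erase ha)
    · rw [card_insert_of_notMem (fun h => hj.2 (mem_of_mem_erase h)), card_erase_of_mem hi.1, hc]
      have := card_pos.2 ⟨i, hi.1⟩
      omega

open Finset in
/-- Relations for all `r`-subsets give differences in the cyclic group of `f`. -/
theorem int_lemma0 {ι G : Type*} [DecidableEq ι] [AddCommGroup G] (B : Finset ι) (x : ι → G)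
    (f : G) (k : Finset ι → ℤ) (r : ℕ) (hr : 1 ≤ r) (hrB : r + 1 ≤ #B)
    (hrel : ∀ I ⊆ B, #I = r → ∀ I' ⊆ B, #I' = r →
      ∑ i ∈ I, x i + k I • f = ∑ i ∈ I', x i + k I' • f) :
    ∃ b0 : G, ∃ y : ι → ℤ, ∀ i ∈ B, x i = b0 + y i • f := by
  obtain ⟨i0, hi0⟩ := card_pos.1 (show 0 < #B by omega)
  have : ∀ i, ∃ y : ℤ, i ∈ B → x i = x i0 + y • f := by
    intro i
    by_cases hi : i ∈ B
    swap
    · exact ⟨0, fun h => absurd h hi⟩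
    by_cases h : i = i0
    · exact ⟨0, fun _ => by simp [h]⟩
    obtain ⟨R, hR, hRc⟩ := exists_subset_card_eq (s := (B.erase i).erase i0) (n := r - 1) (by
      rw [card_erase_of_mem (mem_erase.2 ⟨Ne.symm h, hi0⟩), card_erase_of_mem hi]; omega)
    have hiR : i ∉ R := fun h => by simpa using hR h
    have hi0R : i0 ∉ R := fun h => by simpa using hR h
    have hRB : R ⊆ B := fun a ha => mem_of_mem_erase (mem_of_mem_erase (hR ha))
    have h1 := hrel (insert i R) (insert_subset hi hRB) (by
      rw [card_insert_of_notMem hiR]; omega) (insert i0 R) (insert_subset hi0 hRB) (by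
      rw [card_insert_of_notMem hi0R]; omega)
    rw [sum_insert hiR, sum_insert hi0R] at h1
    refine ⟨k (insert i0 R) - k (insert i R), fun _ => ?_⟩
    rw [sub_smul]
    have := sub_eq_zero.2 h1
    rw [← sub_eq_zero, ← this]; abel
  choose y hy using this
  exact ⟨x i0, y, hy⟩

open Finset in
theorem int_lemma {ι G : Type*} [DecidableEq ι] [AddCommGroup G] (B : Finset ι) (x : ι → G)
    (f : G) (k : Finset ι → ℤ) (m r : ℕ) (hr : 1 ≤ r) (hrB : r + 2 ≤ #B)
    (hk : ∀ I ⊆ B, #I = r → 0 ≤ k I ∧ k I < m)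
    (hz : ∀ z : ℤ, |z| < 2 * m → z • f = 0 → z = 0)
    (hrel : ∀ I ⊆ B, #I = r → ∀ I' ⊆ B, #I' = r →
      ∑ i ∈ I, x i + k I • f = ∑ i ∈ I', x i + k I' • f) :
    ∃ b0 : G, ∃ y : ι → ℤ, (∀ i ∈ B, x i = b0 + y i • f) ∧ (∀ i ∈ B, ∀ j ∈ B, |y i - y j| < m) ∧
      ∀ I ⊆ B, #I = r → ∀ I' ⊆ B, #I' = r → k I + ∑ i ∈ I, y i = k I' + ∑ i ∈ I', y i := by
  classical
  obtain ⟨i0, hi0⟩ := card_pos.1 (show 0 < #B by omega)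
  -- basic swap relation
  have sw : ∀ R : Finset ι, ∀ i j, R ⊆ B → #R = r - 1 → i ∈ B → j ∈ B → i ∉ R → j ∉ R →
      x i - x j = (k (insert j R) - k (insert i R)) • f ∧
      |k (insert j R) - k (insert i R)| < m := by
    intro R i j hRB hRc hi hj hiR hjR
    have ci : #(insert i R) = r := by rw [card_insert_of_notMem hiR]; omega
    have cj : #(insert j R) = r := by rw [card_insert_of_notMem hjR]; omega
    have h1 := hrel (insert i R) (insert_subset hi hRB) ci (insert j R) (insert_subset hj hRB) cj
    rw [sum_insert hiR, sum_insert hjR] at h1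
    constructor
    · rw [sub_smul]
      have := sub_eq_zero.2 h1
      rw [← sub_eq_zero, ← this]; abel
    · have h1 := hk (insert i R) (insert_subset hi hRB) ci
      have h2 := hk (insert j R) (insert_subset hj hRB) cj
      rw [abs_lt]; constructor <;> omega
  have exR : ∀ i j l, ∃ R ⊆ B, #R = r - 1 ∧ i ∉ R ∧ j ∉ R ∧ l ∉ R := by
    intro i j l
    obtain ⟨R, hR, hRc⟩ := exists_subset_card_eq (s := B \ {i, j, l}) (n := r - 1) (by
      have h1 := le_card_sdiff {i, j, l} B
      have h2 : #({i, j, l} : Finset ι) ≤ 3 := card_le_three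
      omega)
    refine ⟨R, hR.trans sdiff_subset, hRc, ?_, ?_, ?_⟩ <;>
    · intro h
      have := hR h
      simp at this
  have uniq : ∀ a b : ℤ, |a| < m → |b| < m → a • f = b • f → a = b := by
    intro a b ha hb h
    have := hz (a - b) (by rw [abs_lt] at *; constructor <;> omega) (by rw [sub_smul, h, sub_self])
    omega
  have hd : ∀ i, ∃ d : ℤ, i ∈ B → |d| < m ∧ x i - x i0 = d • f := by
    intro i
    by_cases hi : i ∈ B
    · obtain ⟨R, hRB, hRc, h1, h2, -⟩ := exR i i0 i0
      have := sw R i i0 hRB hRc hi hi0 h1 h2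
      exact ⟨_, fun _ => ⟨this.2, this.1⟩⟩
    · exact ⟨0, fun h => absurd h hi⟩
  choose y hy using hd
  have hyd : ∀ R : Finset ι, ∀ i j, R ⊆ B → #R = r - 1 → i ∈ B → j ∈ B → i ∉ R → j ∉ R →
      y i - y j = k (insert j R) - k (insert i R) := by
    intro R i j hRB hRc hi hj hiR hjR
    have h1 := sw R i j hRB hRc hi hj hiR hjR
    obtain ⟨R', hRB', hRc', h2, h3, h4⟩ := exR i j i0
    have h5 := sw R' i j hRB' hRc' hi hj h2 h3
    have h6 := sw R' i i0 hRB' hRc' hi hi0 h2 h4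
    have h7 := sw R' j i0 hRB' hRc' hj hi0 h3 h4
    have e1 := uniq _ _ h1.2 h5.2 (by rw [← h1.1, ← h5.1])
    have e2 := uniq _ _ (hy i hi).1 h6.2 (by rw [← (hy i hi).2, ← h6.1])
    have e3 := uniq _ _ (hy j hj).1 h7.2 (by rw [← (hy j hj).2, ← h7.1])
    omega
  refine ⟨x i0, y, fun i hi => ?_, fun i hi j hj => ?_, ?_⟩
  · rw [← (hy i hi).2]; abel
  · obtain ⟨R, hRB, hRc, h1, h2, -⟩ := exR i j i0
    rw [hyd R i j hRB hRc hi hj h1 h2]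
    exact (sw R i j hRB hRc hi hj h1 h2).2
  · apply swap_const B r (fun I => k I + ∑ i ∈ I, y i)
    intro I hI hc i hi j hj hjI
    have h1 := hyd (I.erase i) i j ((erase_subset _ _).trans hI)
      (by rw [card_erase_of_mem hi]; omega) (hI hi) hj (by simp)
      (fun h => hjI (mem_of_mem_erase h))
    rw [insert_erase hi] at h1
    have h2 := add_sum_erase I y hi
    rw [sum_insert (fun h => hjI (mem_of_mem_erase h))]
    omega

open Finset in
theorem sub_sum_nonpos {ι : Type*} [DecidableEq ι] (y : ι → ℤ) (B : Finset ι) (h : ∑ i ∈ B, y i ≤ 0)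
    (t : ℕ) (ht : t ≤ #B) : ∃ K ⊆ B, #K = t ∧ ∑ i ∈ K, y i ≤ 0 := by
  induction B using Finset.strongInduction with
  | H B ih =>
    by_cases h0 : t = #B
    · exact ⟨B, Subset.rfl, h0.symm, h⟩
    have : ∃ a ∈ B, ∑ i ∈ B.erase a, y i ≤ 0 := by
      by_cases hp : ∃ a ∈ B, 0 ≤ y a
      · obtain ⟨a, ha, hya⟩ := hp
        refine ⟨a, ha, ?_⟩
        have := add_sum_erase B y ha
        omega
      · push Not at hp
        obtain ⟨a, ha⟩ := card_pos.1 (show 0 < #B by omega)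
        refine ⟨a, ha, sum_nonpos fun i hi => (hp i (mem_of_mem_erase hi)).le⟩
    obtain ⟨a, ha, hs⟩ := this
    obtain ⟨K, hK, h1, h2⟩ := ih (B.erase a) (erase_ssubset ha) hs
      (by rw [card_erase_of_mem ha]; omega)
    exact ⟨K, hK.trans (erase_subset _ _), h1, h2⟩

open Finset in
theorem y_lemma {ι : Type*} [DecidableEq ι] (y : ι → ℤ) (B : Finset ι) (h : ∑ i ∈ B, y i = 1)
    (r : ℕ) (hr : 1 ≤ r) (hrB : r + 2 ≤ #B) (hK : ∀ K ⊆ B, #K = r → 0 ≤ ∑ i ∈ K, y i) :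
    ∃ j ∈ B, y j = 1 ∧ ∀ i ∈ B, i ≠ j → y i = 0 := by
  obtain ⟨K, hKm, hmin⟩ := exists_min_image (powersetCard r B) (fun K => ∑ i ∈ K, y i)
    (powersetCard_nonempty.2 (by omega))
  rw [mem_powersetCard] at hKm
  have hsw : ∀ i ∈ K, ∀ j ∈ B \ K, y i ≤ y j := by
    intro i hi j hj
    rw [mem_sdiff] at hj
    have hj' : j ∉ K.erase i := fun h => hj.2 (mem_of_mem_erase h)
    have := hmin (insert j (K.erase i)) (by
      rw [mem_powersetCard]
      refine ⟨insert_subset hj.1 ((erase_subset _ _).trans hKm.1), ?_⟩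
      rw [card_insert_of_notMem hj', card_erase_of_mem hi]; omega)
    rw [sum_insert hj', ← add_sum_erase K y hi] at this
    omega
  have h1 := sum_sdiff hKm.1 (f := y)
  have hK0 := hK K hKm.1 hKm.2
  have : ∃ j ∈ B \ K, y j ≤ 0 := by
    by_contra hcon
    push Not at hcon
    have h2 : #(B \ K) • (1:ℤ) ≤ ∑ i ∈ B \ K, y i := card_nsmul_le_sum (B \ K) y 1 (fun i hi => hcon i hi)
    rw [card_sdiff_of_subset hKm.1, hKm.2] at h2
    simp at h2
    omega
  obtain ⟨j0, hj0, hj0'⟩ := this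
  have hle : ∀ i ∈ K, y i ≤ 0 := fun i hi => (hsw i hi j0 hj0).trans hj0'
  have hKz : ∀ i ∈ K, y i = 0 := by
    have h3 : ∑ i ∈ K, y i = 0 := le_antisymm (sum_nonpos hle) hK0
    exact fun i hi => (sum_eq_zero_iff_of_nonpos hle).1 h3 i hi
  obtain ⟨i1, hi1⟩ := card_pos.1 (show 0 < #K by omega)
  have hnn : ∀ i ∈ B, 0 ≤ y i := by
    intro i hi
    by_cases hiK : i ∈ K
    · exact (hKz i hiK).ge
    · rw [← hKz i1 hi1]; exact hsw i1 hi1 i (mem_sdiff.2 ⟨hi, hiK⟩)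
  have : ∃ j ∈ B, y j ≠ 0 := by
    by_contra hcon
    push Not at hcon
    rw [sum_eq_zero hcon] at h; omega
  obtain ⟨j, hj, hne⟩ := this
  have h4 := add_sum_erase B y hj
  have h5 : 0 ≤ ∑ i ∈ B.erase j, y i := sum_nonneg fun i hi => hnn i (mem_of_mem_erase hi)
  have h6 := hnn j hj
  have h7 : ∑ i ∈ B.erase j, y i = 0 := by omega
  refine ⟨j, hj, by omega, fun i hi hij => ?_⟩
  exact (sum_eq_zero_iff_of_nonneg fun i hi => hnn i (mem_of_mem_erase hi)).1 h7 i
    (mem_erase.2 ⟨hij, hi⟩)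

open Finset in
/-- The main induction on subsets of a bad block. -/
theorem block_ind {ι G : Type*} [DecidableEq ι] [AddCommGroup G] (m : ℕ) (hm : 2 ≤ m)
    (T Bs : Finset ι) (hBc : #Bs = m) (vv : ι → ℕ) (w y : ι → ℤ) (X Y : G)
    (hXY : X + Y ≠ 0)
    (fill : ∀ B ⊂ T, ∀ I ⊆ Bs, I.Nonempty → ∀ k : ℕ, k < m → ∀ α β : ℤ,
      ((∑ h ∈ B, vv h + #I : ℕ) : ℤ) = m * α → ∑ h ∈ B, w h + ∑ i ∈ I, y i + k = m * β →
      α • X + β • Y = X + Y)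
    (hv : ∀ h ∈ T, vv h < m)
    (hy : ∑ i ∈ Bs, y i = 1)
    (hw : Y ≠ 0 → ∀ h ∈ T, ∀ K ⊆ Bs, #K = m - vv h → 1 ≤ w h + ∑ i ∈ K, y i ∧
      w h + ∑ i ∈ K, y i ≤ m - vv h + 1) :
    ∀ B ⊂ T, ∀ I ⊆ Bs, I.Nonempty → m ∣ ∑ h ∈ B, vv h + #I →
      (Y ≠ 0 → 1 ≤ ∑ h ∈ B, w h + ∑ i ∈ I, y i ∧ ∑ h ∈ B, w h + ∑ i ∈ I, y i ≤ m) ∧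
      (X ≠ 0 → ∑ h ∈ B, vv h + #I = m) := by
  intro B
  induction B using Finset.induction with
  | empty =>
    intro hB I hI hne hd
    simp only [sum_empty, zero_add] at hd ⊢
    have h1 := card_le_card hI
    have h2 := card_pos.2 hne
    have h3 := Nat.le_of_dvd h2 hd
    have : I = Bs := eq_of_subset_of_card_le hI (by omega)
    subst this
    rw [hy]
    exact ⟨fun _ => ⟨le_rfl, by omega⟩, fun _ => hBc⟩
  | insert h B hhB ih =>
    intro hB I hI hne hd
    have hBT : B ⊂ T   := Finset.ssubset_of_subset_of_ssubset (subset_insert _ _) hB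
    have hhT : h ∈ T := hB.1 (mem_insert_self _ _)
    have hvh := hv h hhT
    have hIpos := card_pos.2 hne
    have hIm := card_le_card hI
    rw [hBc] at hIm
    rw [sum_insert hhB] at hd
    -- choose the comparison set
    have key : ∃ I' ⊆ Bs, I'.Nonempty ∧ m ∣ ∑ h ∈ B, vv h + #I' ∧
        (#I + vv h = #I' ∨ #I + vv h = #I' + m) ∧
        (Y ≠ 0 → 0 ≤ w h + ∑ i ∈ I, y i - ∑ i ∈ I', y i ∧
          w h + ∑ i ∈ I, y i - ∑ i ∈ I', y i ≤ m) := by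
      by_cases hc : #I + vv h ≤ m
      · obtain ⟨K, hK, hKc⟩ := exists_subset_card_eq (s := Bs \ I) (n := vv h) (by
          rw [card_sdiff_of_subset hI]; omega)
        have hdis : Disjoint I K := disjoint_of_subset_right hK disjoint_sdiff
        refine ⟨I ∪ K, union_subset hI (hK.trans sdiff_subset), hne.mono subset_union_left, ?_,
          Or.inl ?_, ?_⟩
        · rw [card_union_of_disjoint hdis, hKc]
          convert hd using 1; omega
        · rw [card_union_of_disjoint hdis, hKc]
        · intro hY
          have hKB : K ⊆ Bs := hK.trans sdiff_subset
          have h1 := hw hY h hhT (Bs \ K) sdiff_subset (by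
            rw [card_sdiff_of_subset hKB, hBc, hKc])
          have h2 := sum_sdiff hKB (f := y)
          rw [sum_union hdis]
          constructor <;> omega
      · obtain ⟨K, hK, hKc⟩ := exists_subset_card_eq (s := I) (n := m - vv h) (by omega)
        have hcs : #(I \ K) = #I - (m - vv h) := by rw [card_sdiff_of_subset hK, hKc]
        refine ⟨I \ K, sdiff_subset.trans hI, card_pos.1 (by omega), ?_, Or.inr (by omega), ?_⟩
        · rw [← Nat.dvd_add_left (dvd_refl m)]
          convert hd using 1; omega
        · intro hY
          have h1 := hw hY h hhT K (hK.trans hI) hKc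
          have h2 := sum_sdiff hK (f := y)
          constructor <;> omega
    obtain ⟨I', hI', hne', hd', hcI, hyI⟩ := key
    obtain ⟨ih1, ih2⟩ := ih hBT I' hI' hne' hd'
    have hα : X ≠ 0 → (∑ h ∈ insert h B, vv h + #I = m ∨ ∑ h ∈ insert h B, vv h + #I = 2 * m) := by
      intro hX
      have := ih2 hX
      rw [sum_insert hhB]
      omega
    obtain ⟨α, hα'⟩ : ∃ α : ℤ, ((∑ h ∈ insert h B, vv h + #I : ℕ) : ℤ) = m * α := by
      rw [sum_insert hhB]
      obtain ⟨q, hq⟩ := hd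
      exact ⟨q, by rw [hq]; push_cast; rfl⟩
    have hα2 : X ≠ 0 → (∑ h ∈ insert h B, vv h + #I = m) ∨ α = 2 := by
      intro hX
      rcases hα hX with h | h
      · exact Or.inl h
      · right
        rw [h] at hα'
        push_cast at hα'
        have : (m:ℤ) * 2 = m * α := by linarith
        exact (mul_left_cancel₀ (by positivity) this).symm
    have hα1 : X ≠ 0 → (∑ h ∈ insert h B, vv h + #I = m) → α = 1 := by
      intro hX h
      rw [h] at hα'
      have : (m:ℤ) * 1 = m * α := by linarith
      exact (mul_left_cancel₀ (by positivity) this).symm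
    have fl := fill (insert h B) hB I hI hne
    by_cases hY : Y = 0
    · refine ⟨fun h => absurd hY h, fun hX => ?_⟩
      rcases hα2 hX with h' | h'
      · exact h'
      exfalso
      set z := ∑ h ∈ insert h B, w h + ∑ i ∈ I, y i
      have hmod := Int.emod_nonneg (-z) (show (m:ℤ) ≠ 0 by positivity)
      have hmod2 := Int.emod_lt_of_pos (-z) (show (0:ℤ) < m by positivity)
      have hdm := Int.emod_add_mul_ediv (-z) m
      have := fl ((-z) % m).toNat (by omega) α (-((-z)/m)) hα' (by
        rw [Int.toNat_of_nonneg hmod]; linarith)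
      rw [h', hY, smul_zero, add_zero, add_zero, two_smul] at this
      exact hX (by simpa using this)
    · have h1 := ih1 hY
      have h2 := hyI hY
      have hz : ∑ h ∈ insert h B, w h + ∑ i ∈ I, y i =
        (∑ h ∈ B, w h + ∑ i ∈ I', y i) + (w h + ∑ i ∈ I, y i - ∑ i ∈ I', y i) := by
        rw [sum_insert hhB]; ring
      set z := ∑ h ∈ insert h B, w h + ∑ i ∈ I, y i
      have hzm : z ≤ m := by
        by_contra hcon
        have := fl (2 * m - z).toNat (by omega) α 2 hα' (by
          rw [Int.toNat_of_nonneg (by omega)]; ring)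
        by_cases hX : X = 0
        · rw [hX, smul_zero, zero_add, zero_add, two_smul] at this
          exact hY (by simpa using this)
        · rcases hα2 hX with h | h
          · rw [hα1 hX h, one_smul, two_smul] at this
            exact hY (by simpa using this)
          · rw [h, ← smul_add, two_smul] at this
            exact hXY (by simpa using this)
      refine ⟨fun _ => ⟨by omega, hzm⟩, fun hX => ?_⟩
      rcases hα2 hX with h | h
      · exact h
      exfalso
      have := fl (m - z).toNat (by omega) α 1 hα' (by
          rw [Int.toNat_of_nonneg (by omega)]; ring)
      rw [h, one_smul, two_smul] at this
      exact hX (by simpa using this)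


/-- Coordinates adapted to a minimal block `U`. -/
structure Fr {G ι : Type*} [AddCommGroup G] [DecidableEq ι]
    (m : ℕ) (x : ι → G) (H : AddSubgroup G) (U F : Finset ι) (u v : G →+ ZMod m) : Prop where
  fr : ∀ g, g ∈ H ↔ u g = 0 ∧ v g = 0
  hUc : U.card = 2 * m - 1
  hUz : ∑ i ∈ U, x i ∈ H
  hFU : F ⊆ U
  hFc : F.card = m - 1
  hF1 : ∀ i ∈ F, u (x i) = 1
  hF0 : ∀ i ∈ F, v (x i) = 0
  hB : ∀ i ∈ U \ F, v (x i) = 1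

/-- A block disjoint from `U`. -/
structure Blk {G ι : Type*} [AddCommGroup G] [Fintype ι] [DecidableEq ι]
    (m n : ℕ) (x : ι → G) (H : AddSubgroup G) (U T : Finset ι) : Prop where
  hd : Disjoint T U
  hc : T.card = m
  hz : ∑ i ∈ T, x i ∈ H
  hK : Good n x H (T ∪ U)

section
variable {G ι : Type*} [AddCommGroup G] [Fintype ι] [DecidableEq ι]
  {m n : ℕ} {x : ι → G} {H : AddSubgroup G} {U F T : Finset ι} {u v : G →+ ZMod m}

open Finset in
theorem Fr.cardB (c : Ctx m n x H) (f : Fr m x H U F u v) : #(U \ F) = m := by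
  have := c.hm
  rw [card_sdiff_of_subset f.hFU, f.hUc, f.hFc]; omega

open Finset in
theorem Fr.sumB (c : Ctx m n x H) (f : Fr m x H U F u v) : ∑ i ∈ U \ F, u (x i) = 1 := by
  have := c.hm
  have h1 := ((f.fr _).1 f.hUz).1
  rw [map_sum, ← sum_sdiff f.hFU, sum_congr rfl f.hF1, sum_const, f.hFc, nsmul_eq_mul, mul_one,
    Nat.cast_sub (by omega)] at h1
  simp at h1
  linear_combination h1

open Finset in
theorem Fr.e_sum (c : Ctx m n x H) (hn : 2 ≤ n) (f : Fr m x H U F u v) (b : Blk m n x H U T) :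
    addOrderOf (∑ i ∈ U, x i) = n ∧ ∀ J : Finset ι, J.Nonempty → J ⊂ T ∪ U → ∑ i ∈ J, x i ∈ H →
      ∑ i ∈ J, x i = ∑ i ∈ U, x i := by
  have hm := c.hm
  have hTU : U ⊂ T ∪ U := by
    refine Finset.ssubset_iff_subset_ne.2 ⟨subset_union_right, fun h => ?_⟩
    have h1 := card_union_of_disjoint b.hd
    rw [← h, b.hc] at h1
    omega
  exact c.good_sum hn b.hK (card_pos.1 (by rw [f.hUc]; omega)) hTU f.hUz

open Finset in
theorem Fr.fill (c : Ctx m n x H) (hn : 2 ≤ n) (f : Fr m x H U F u v) (b : Blk m n x H U T)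
    {A : Finset ι} (hA : A ⊂ T ∪ (U \ F)) (hne : A.Nonempty) (hv : v (∑ i ∈ A, x i) = 0)
    {F' : Finset ι} (hF' : F' ⊆ F) (hu : (#F' : ZMod m) = - u (∑ i ∈ A, x i)) :
    ∑ i ∈ A, x i + ∑ i ∈ F', x i = ∑ i ∈ U, x i ∧ m ≤ #A + #F' := by
  have hdF : ∀ a ∈ T ∪ (U \ F), a ∉ F := by
    intro a ha haF
    rcases mem_union.1 ha with h | h
    · exact disjoint_left.1 b.hd h (f.hFU haF)
    · exact (mem_sdiff.1 h).2 haF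
  have hdis : Disjoint A F' := disjoint_left.2 fun a ha ha' => hdF a (hA.1 ha) (hF' ha')
  have hz : ∑ i ∈ A ∪ F', x i ∈ H := by
    rw [f.fr, sum_union hdis, map_add, map_add, hv, map_sum _ _ F', map_sum _ _ F',
      sum_congr rfl (fun i hi => f.hF1 i (hF' hi)), sum_congr rfl (fun i hi => f.hF0 i (hF' hi))]
    simp [hu]
  have hne' : (A ∪ F').Nonempty := hne.mono subset_union_left
  rw [← sum_union hdis, ← card_union_of_disjoint hdis]
  refine ⟨(f.e_sum c hn b).2 _ hne' ?_ hz, c.le_card hne' hz⟩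
  obtain ⟨a, ha, haA⟩ := exists_of_ssubset hA
  rw [ssubset_iff_of_subset]
  · refine ⟨a, ?_, ?_⟩
    · exact union_subset_union_right sdiff_subset ha
    · rw [mem_union]
      rintro (h | h)
      · exact haA h
      · exact hdF a ha (hF' h)
  · exact union_subset (hA.1.trans (union_subset_union_right sdiff_subset))
      (hF'.trans (f.hFU.trans subset_union_right))

open Finset in
theorem Fr.ins (c : Ctx m n x H) (f : Fr m x H U F u v) (b : Blk m n x H U T)
    {h : ι} (hh : h ∈ T) {I : Finset ι} (hI : I ⊆ U \ F) (hc : #I = m - (v (x h)).val) :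
    h ∉ I ∧ insert h I ⊂ T ∪ (U \ F) ∧ v (∑ i ∈ insert h I, x i) = 0 := by
  have hm := c.hm
  have : NeZero m := ⟨by omega⟩
  have hdT : ∀ t ∈ T, t ∉ I := fun t ht htI => disjoint_left.1 b.hd ht (mem_sdiff.1 (hI htI)).1
  refine ⟨hdT h hh, ?_, ?_⟩
  · obtain ⟨t, ht, hth⟩ := exists_mem_ne (show 1 < #T by rw [b.hc]; omega) h
    rw [ssubset_iff_of_subset]
    · refine ⟨t, mem_union_left _ ht, fun h => ?_⟩
      rcases mem_insert.1 h with h | h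
      · exact hth h
      · exact hdT t ht h
    · exact insert_subset (mem_union_left _ hh) (hI.trans subset_union_right)
  · rw [sum_insert (hdT h hh), map_add, map_sum, sum_congr rfl (fun i hi => f.hB i (hI hi)),
      sum_const, hc, nsmul_eq_mul, mul_one, Nat.cast_sub (ZMod.val_lt _).le]
    simp

open Finset in
theorem Fr.rel (c : Ctx m n x H) (hn : 2 ≤ n) (f : Fr m x H U F u v) (b : Blk m n x H U T)
    {h : ι} (hh : h ∈ T) {I : Finset ι} (hI : I ⊆ U \ F) (hc : #I = m - (v (x h)).val)
    {F' : Finset ι} (hF' : F' ⊆ F) (hk : #F' = (-(u (∑ i ∈ insert h I, x i))).val) :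
    x h + ∑ i ∈ I, x i + ∑ i ∈ F', x i = ∑ i ∈ U, x i ∧ m ≤ 1 + #I + #F' := by
  have hm := c.hm
  have : NeZero m := ⟨by omega⟩
  obtain ⟨h1, h2, h3⟩ := f.ins c b hh hI hc
  have := f.fill c hn b h2 (insert_nonempty _ _) h3 hF' (by rw [hk]; simp)
  rw [sum_insert h1, card_insert_of_notMem h1] at this
  refine ⟨this.1, by omega⟩

open Finset in
theorem Fr.constF (c : Ctx m n x H) (hn : 2 ≤ n) (f : Fr m x H U F u v) (b : Blk m n x H U T)
    {g : ι} (hg : g ∈ T) (hg0 : v (x g) ≠ 0) (hg1 : v (x g) ≠ 1) :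
    ∃ f1, ∀ i ∈ F, x i = f1 := by
  have hm := c.hm
  have : NeZero m := ⟨by omega⟩
  have : Fact (1 < m) := ⟨by omega⟩
  have hBc := f.cardB c
  set r := m - (v (x g)).val with hr
  have hv1 := ZMod.val_lt (v (x g))
  have hv2 : 2 ≤ (v (x g)).val := by
    by_contra hcon
    have : (v (x g)).val = 0 ∨ (v (x g)).val = 1 := by omega
    rcases this with h | h
    · exact hg0 (by rw [← ZMod.natCast_zmod_val (v (x g)), h]; simp)
    · exact hg1 (by rw [← ZMod.natCast_zmod_val (v (x g)), h]; simp)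
  by_cases hex : ∃ I ⊆ U \ F, #I = r ∧ (-(u (∑ i ∈ insert g I, x i))).val ≤ m - 2
  · obtain ⟨I, hI, hIc, hk⟩ := hex
    set k := (-(u (∑ i ∈ insert g I, x i))).val with hkdef
    have hk1 : 1 ≤ k := by
      obtain ⟨F', hF', hF'c⟩ := exists_subset_card_eq (s := F) (n := k) (by rw [f.hFc]; omega)
      have := (f.rel c hn b hg hI hIc hF' hF'c).2
      omega
    obtain ⟨i0, hi0⟩ := card_pos.1 (show 0 < #F by rw [f.hFc]; omega)
    refine ⟨x i0, fun i hi => ?_⟩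
    by_cases hii : i = i0
    · rw [hii]
    obtain ⟨R, hR, hRc⟩ := exists_subset_card_eq (s := (F.erase i).erase i0) (n := k - 1) (by
      rw [card_erase_of_mem (mem_erase.2 ⟨Ne.symm hii, hi0⟩), card_erase_of_mem hi, f.hFc]; omega)
    have hiR : i ∉ R := fun h => by simpa using hR h
    have hi0R : i0 ∉ R := fun h => by simpa using hR h
    have hRB : R ⊆ F := fun a ha => mem_of_mem_erase (mem_of_mem_erase (hR ha))
    have h1 := (f.rel c hn b hg hI hIc (insert_subset hi hRB)
      (by rw [card_insert_of_notMem hiR]; omega)).1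
    have h2 := (f.rel c hn b hg hI hIc (insert_subset hi0 hRB)
      (by rw [card_insert_of_notMem hi0R]; omega)).1
    rw [sum_insert hiR] at h1
    rw [sum_insert hi0R, ← h1] at h2
    simpa using h2.symm
  · exfalso
    push Not at hex
    have hu : ∀ I ⊆ U \ F, #I = r → ∑ i ∈ I, u (x i) = 1 - u (x g) := by
      intro I hI hIc
      have h1 := hex I hI hIc
      have h2 := ZMod.val_lt (-(u (∑ i ∈ insert g I, x i)))
      have h3 : (-(u (∑ i ∈ insert g I, x i))).val = m - 1 := by omega
      have h4 := ZMod.natCast_zmod_val (-(u (∑ i ∈ insert g I, x i)))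
      rw [h3, Nat.cast_sub (by omega), sum_insert (f.ins c b hg hI hIc).1, map_add, map_sum] at h4
      simp at h4
      linear_combination h4
    obtain ⟨b0, y, hy⟩ := int_lemma0 (U \ F) (fun i => u (x i)) 0 (fun _ => 0) r (by omega)
      (by omega) (fun I hI hc I' hI' hc' => by simp [hu I hI hc, hu I' hI' hc'])
    have h1 := f.sumB c
    rw [sum_congr rfl hy] at h1
    simp [hBc] at h1

end


section
variable {G ι : Type*} [AddCommGroup G] [Fintype ι] [DecidableEq ι]
  {m n : ℕ} {x : ι → G} {H : AddSubgroup G} {U F T : Finset ι} {u v : G →+ ZMod m}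

theorem small_mult (hm : 2 ≤ m) {f1 : G} (hu : u f1 = 1) (hY : m • f1 ≠ 0) (z : ℤ)
    (hz : |z| < 2 * m) (h0 : z • f1 = 0) : z = 0 := by
  have h1 : (z : ZMod m) = 0 := by
    have := congrArg u h0
    rw [map_zsmul, hu, map_zero] at this
    simpa using this
  obtain ⟨q, rfl⟩ := (ZMod.intCast_zmod_eq_zero_iff_dvd z m).1 h1
  rw [abs_lt] at hz
  have h2 : q < 2 := by
    by_contra hcon
    nlinarith
  have h3 : -2 < q := by
    by_contra hcon
    nlinarith
  have : q = -1 ∨ q = 0 ∨ q = 1 := by omega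
  rcases this with rfl | rfl | rfl
  · exfalso; apply hY; simpa using h0
  · simp
  · exfalso; apply hY; simpa using h0

open Finset in
/-- the parametrisation of the `B` part of `U` -/
theorem Fr.param (c : Ctx m n x H) (hn : 2 ≤ n) (f : Fr m x H U F u v) (b : Blk m n x H U T)
    {g : ι} (hg : g ∈ T) (hg2 : 2 ≤ (v (x g)).val) {f1 : G} (hf1 : ∀ i ∈ F, x i = f1)
    (hu1 : u f1 = 1) :
    ∃ b0 : G, ∃ y : ι → ℤ, (∀ i ∈ U \ F, x i = b0 + y i • f1) ∧
      (m • f1 ≠ 0 → ∀ i ∈ U \ F, ∀ j ∈ U \ F, |y i - y j| < m) ∧ ∑ i ∈ U \ F, y i = 1 := by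
  have hm := c.hm
  have : NeZero m := ⟨by omega⟩
  have hBc := f.cardB c
  have hv1 := ZMod.val_lt (v (x g))
  set r := m - (v (x g)).val with hr
  let k : Finset ι → ℤ := fun I => ((-(u (∑ i ∈ insert g I, x i))).val : ℕ)
  have hk : ∀ I, 0 ≤ k I ∧ k I < m := by
    intro I
    have := ZMod.val_lt (-(u (∑ i ∈ insert g I, x i)))
    simp only [k]
    constructor <;> omega
  have hrel : ∀ I ⊆ U \ F, #I = r → ∑ i ∈ I, x i + k I • f1 = ∑ i ∈ U, x i - x g := by
    intro I hI hc
    obtain ⟨F', hF', hF'c⟩ := exists_subset_card_eq (s := F)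
      (n := (-(u (∑ i ∈ insert g I, x i))).val) (by
        have := ZMod.val_lt (-(u (∑ i ∈ insert g I, x i)))
        rw [f.hFc]; omega)
    have h1 := (f.rel c hn b hg hI hc hF' hF'c).1
    rw [sum_congr rfl (fun i hi => hf1 i (hF' hi)), sum_const, hF'c] at h1
    rw [← h1]
    simp only [k, natCast_zsmul]
    abel
  have hrel' : ∀ I ⊆ U \ F, #I = r → ∀ I' ⊆ U \ F, #I' = r →
      ∑ i ∈ I, x i + k I • f1 = ∑ i ∈ I', x i + k I' • f1 := fun I hI hc I' hI' hc' => by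
    rw [hrel I hI hc, hrel I' hI' hc']
  have h1 : ∃ b0 : G, ∃ y : ι → ℤ, (∀ i ∈ U \ F, x i = b0 + y i • f1) ∧
      (m • f1 ≠ 0 → ∀ i ∈ U \ F, ∀ j ∈ U \ F, |y i - y j| < m) := by
    by_cases hY : m • f1 = 0
    · obtain ⟨b0, y, h⟩ := int_lemma0 (U \ F) x f1 k r (by omega) (by omega) hrel'
      exact ⟨b0, y, h, fun h => absurd hY h⟩
    · obtain ⟨b0, y, h, h', -⟩ := int_lemma (U \ F) x f1 k m r (by omega) (by omega)
        (fun I _ _ => hk I) (small_mult hm hu1 hY) hrel'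
      exact ⟨b0, y, h, fun _ => h'⟩
  obtain ⟨b0, y, h2, h3⟩ := h1
  have h4 := f.sumB c
  rw [sum_congr rfl (fun i hi => by rw [h2 i hi, map_add, map_zsmul, hu1] :
    ∀ i ∈ U \ F, u (x i) = u b0 + y i • 1)] at h4
  rw [sum_add_distrib, sum_const, hBc] at h4
  simp only [nsmul_eq_mul, CharP.cast_eq_zero, zero_mul, zero_add, zsmul_eq_mul, mul_one] at h4
  have h5 : ((∑ i ∈ U \ F, y i - 1 : ℤ) : ZMod m) = 0 := by
    push_cast; rw [h4]; ring
  obtain ⟨t, ht⟩ := (ZMod.intCast_zmod_eq_zero_iff_dvd _ m).1 h5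
  refine ⟨b0 + t • f1, fun i => y i - t, fun i hi => ?_, fun hY i hi j hj => ?_, ?_⟩
  · rw [h2 i hi, sub_smul]; abel
  · have := h3 hY i hi j hj
    convert this using 2; ring
  · rw [sum_sub_distrib, sum_const, hBc]; simp; linarith

open Finset in
theorem Fr.bad (c : Ctx m n x H) (hn : 2 ≤ n) (f : Fr m x H U F u v) (b : Blk m n x H U T)
    {g : ι} (hg : g ∈ T) (hg0 : v (x g) ≠ 0) (hg1 : v (x g) ≠ 1) :
    ∃ f1 b0 : G, ∃ j0 ∈ U \ F, (∀ i ∈ F, x i = f1) ∧ m • f1 ≠ 0 ∧ m • b0 = 0 ∧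
      (∀ i ∈ U \ F, i ≠ j0 → x i = b0) ∧ x j0 = b0 + f1 ∧ u f1 = 1 ∧ v f1 = 0 ∧ v b0 = 1 ∧
      ∀ h ∈ T, ∃ k : ℕ, x h = k • b0 + f1 := by
  have hm := c.hm
  have : NeZero m := ⟨by omega⟩
  have hBc := f.cardB c
  have hv2 : 2 ≤ (v (x g)).val := by
    by_contra hcon
    have : (v (x g)).val = 0 ∨ (v (x g)).val = 1 := by omega
    rcases this with h | h
    · exact hg0 (by rw [← ZMod.natCast_zmod_val (v (x g)), h]; simp)
    · exact hg1 (by rw [← ZMod.natCast_zmod_val (v (x g)), h]; simp)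
  obtain ⟨f1, hf1⟩ := f.constF c hn b hg hg0 hg1
  obtain ⟨i0, hi0⟩ := card_pos.1 (show 0 < #F by rw [f.hFc]; omega)
  have hu1 : u f1 = 1 := by rw [← hf1 i0 hi0]; exact f.hF1 i0 hi0
  have hv0 : v f1 = 0 := by rw [← hf1 i0 hi0]; exact f.hF0 i0 hi0
  obtain ⟨b0, y, hy, hyd, hy1⟩ := f.param c hn b hg hv2 hf1 hu1
  obtain ⟨i1, hi1⟩ := card_pos.1 (show 0 < #(U \ F) by omega)
  have hvb : v b0 = 1 := by
    rw [← f.hB i1 hi1, hy i1 hi1, map_add, map_zsmul, hv0]; simp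
  set e := ∑ i ∈ U, x i with he
  have heB : e = ∑ i ∈ U \ F, x i + (m - 1) • f1 := by
    rw [he, ← sum_sdiff f.hFU, sum_congr rfl hf1, sum_const, f.hFc]
  have hsumI : ∀ I ⊆ U \ F, ∑ i ∈ I, x i = #I • b0 + (∑ i ∈ I, y i) • f1 := by
    intro I hI
    rw [sum_congr rfl (fun i hi => hy i (hI hi)), sum_add_distrib, sum_const, sum_smul]
  have heXY : e = m • b0 + m • f1 := by
    rw [heB, hsumI _ Subset.rfl, hBc, hy1, one_smul, add_assoc]
    congr 1
    rw [← succ_nsmul', Nat.sub_add_cancel (by omega)]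
  have hene : e ≠ 0 := by
    intro h
    have := (f.e_sum c hn b).1
    rw [← he, h, addOrderOf_zero] at this
    omega
  have fillZ : ∀ A ⊂ T ∪ (U \ F), A.Nonempty → v (∑ i ∈ A, x i) = 0 → ∀ k : ℕ, k < m →
      (k : ZMod m) = - u (∑ i ∈ A, x i) → ∑ i ∈ A, x i + k • f1 = e ∧ m ≤ #A + k := by
    intro A hA hne hv k hk huk
    obtain ⟨F', hF', hF'c⟩ := exists_subset_card_eq (s := F) (n := k) (by rw [f.hFc]; omega)
    have := f.fill c hn b hA hne hv hF' (by rw [hF'c, huk])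
    rw [sum_congr rfl (fun i hi => hf1 i (hF' hi)), sum_const, hF'c] at this
    exact this
  have hTB : ∀ t ∈ T, t ∉ U \ F := fun t ht h => disjoint_left.1 b.hd ht (mem_sdiff.1 h).1
  -- elements of T with v = 0 equal f1
  have hzero : ∀ h ∈ T, (v (x h)).val = 0 → x h = f1 ∧ m • f1 = e := by
    intro h hh hvh
    have hvx : v (x h) = 0 := (ZMod.val_eq_zero _).1 hvh
    obtain ⟨t, ht, hth⟩ := exists_mem_ne (show 1 < #T by rw [b.hc]; omega) h
    have hss : ({h} : Finset ι) ⊂ T ∪ (U \ F) := by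
      rw [ssubset_iff_of_subset (by simp [hh])]
      exact ⟨t, mem_union_left _ ht, by simpa using hth⟩
    have h1 := fillZ {h} hss (by simp) (by simp [hvx]) (-(u (x h))).val (ZMod.val_lt _) (by simp)
    have h2 := ZMod.val_lt (-(u (x h)))
    have h3 : (-(u (x h))).val = m - 1 := by
      have := h1.2; rw [card_singleton] at this; omega
    have hux : u (x h) = 1 := by
      have h4 := ZMod.natCast_zmod_val (-(u (x h)))
      rw [h3, Nat.cast_sub (by omega)] at h4
      simp at h4
      exact h4.symm
    obtain ⟨hn1, hn2, hn3⟩ := f.ins c b hh (Subset.refl (U \ F)) (by rw [hBc, hvh]; rfl)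
    have h5 := (fillZ _ hn2 (insert_nonempty _ _) hn3 (m - 2) (by omega) (by
      rw [sum_insert hn1, map_add, map_sum, f.sumB c, hux, Nat.cast_sub hm]; push_cast; ring_nf
      simp)).1
    rw [sum_insert hn1, heB, show m - 1 = (m - 2) + 1 by omega, succ_nsmul] at h5
    have hxf : x h = f1 := by
      have := sub_eq_zero.2 h5
      rw [← sub_eq_zero, ← this]; abel
    refine ⟨hxf, ?_⟩
    have := h1.1
    rw [sum_singleton, h3, hxf, ← succ_nsmul', Nat.sub_add_cancel (by omega)] at this
    exact this
  -- general elements of T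
  have hT : ∀ h, ∃ w : ℤ, h ∈ T → x h = (v (x h)).val • b0 + w • f1 ∧
      ((v (x h)).val = 0 → w = 1) ∧ (m • f1 ≠ 0 → ∀ K ⊆ U \ F, #K = m - (v (x h)).val →
      1 ≤ w + ∑ i ∈ K, y i ∧ w + ∑ i ∈ K, y i ≤ m - (v (x h)).val + 1) := by
    intro h
    by_cases hh : h ∈ T
    swap
    · exact ⟨0, fun h => absurd h hh⟩
    have hvlt := ZMod.val_lt (v (x h))
    by_cases hvh : (v (x h)).val = 0
    · refine ⟨1, fun _ => ⟨?_, fun _ => rfl, fun _ K hK hKc => ?_⟩⟩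
      · rw [hvh, zero_smul, one_smul, zero_add]; exact (hzero h hh hvh).1
      · have : K = U \ F := eq_of_subset_of_card_le hK (by rw [hKc, hvh, hBc]; rfl)
        rw [this, hy1, hvh]
        constructor <;> push_cast <;> omega
    · have relK : ∀ K ⊆ U \ F, #K = m - (v (x h)).val → ∃ k : ℕ, k < m ∧ (v (x h)).val ≤ k + 1 ∧
          x h = (v (x h)).val • b0 + ((m : ℤ) - ∑ i ∈ K, y i - k) • f1 := by
        intro K hK hKc
        obtain ⟨hn1, hn2, hn3⟩ := f.ins c b hh hK hKc
        have hlt := ZMod.val_lt (-(u (∑ i ∈ insert h K, x i)))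
        have h1 := fillZ _ hn2 (insert_nonempty _ _) hn3 (-(u (∑ i ∈ insert h K, x i))).val hlt
          (by simp)
        generalize (-(u (∑ i ∈ insert h K, x i))).val = k at hlt h1
        refine ⟨k, hlt, ?_, ?_⟩
        · have := h1.2
          rw [card_insert_of_notMem hn1, hKc] at this
          omega
        · have h2 := h1.1
          rw [sum_insert hn1, hsumI K hK, hKc, heXY] at h2
          have h3 : m • b0 = (m - (v (x h)).val) • b0 + (v (x h)).val • b0 := by
            rw [← add_smul]; congr 1; omega
          rw [h3] at h2
          have := sub_eq_zero.2 h2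
          rw [← sub_eq_zero, ← this, sub_smul, sub_smul, natCast_zsmul, natCast_zsmul]
          abel
      obtain ⟨K0, hK0, hK0c⟩ := exists_subset_card_eq (s := U \ F) (n := m - (v (x h)).val)
        (by omega)
      obtain ⟨k0, hk0, hk0', hx0⟩ := relK K0 hK0 hK0c
      by_cases hY : m • f1 = 0
      · exact ⟨_, fun _ => ⟨hx0, fun h => absurd h hvh, fun h => absurd hY h⟩⟩
      have relK' : ∀ K, ∃ k : ℕ, K ⊆ U \ F → #K = m - (v (x h)).val → k < m ∧
          (v (x h)).val ≤ k + 1 ∧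
          x h = (v (x h)).val • b0 + ((m : ℤ) - ∑ i ∈ K, y i - k) • f1 := by
        intro K
        by_cases hK : K ⊆ U \ F ∧ #K = m - (v (x h)).val
        · obtain ⟨k, hk⟩ := relK K hK.1 hK.2
          exact ⟨k, fun _ _ => hk⟩
        · exact ⟨0, fun h1 h2 => absurd ⟨h1, h2⟩ hK⟩
      choose k hk using relK'
      have hconst := swap_const (U \ F) (m - (v (x h)).val) (fun K => ∑ i ∈ K, y i + (k K : ℤ)) (by
        intro I hI hIc i hi j hj hjI
        have hj' : j ∉ I.erase i := fun h => hjI (mem_of_mem_erase h)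
        have hI' : insert j (I.erase i) ⊆ U \ F :=
          insert_subset hj ((erase_subset _ _).trans hI)
        have hpos := card_pos.2 ⟨i, hi⟩
        have h1 := hk I hI hIc
        have h2 := hk (insert j (I.erase i)) hI' (by
          rw [card_insert_of_notMem hj', card_erase_of_mem hi]; omega)
        have h3 := h1.2.2.symm.trans h2.2.2
        have h4 := sub_eq_zero.2 (add_left_cancel h3)
        rw [← sub_smul] at h4
        have h5 := abs_lt.1 (hyd hY i (hI hi) j hj)
        have h6 := sum_insert (f := y) hj'
        have h7 := add_sum_erase I y hi
        have h8 := small_mult hm hu1 hY _ (by rw [abs_lt]; constructor <;> omega) h4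
        omega)
      have h0 := hk K0 hK0 hK0c
      refine ⟨(m : ℤ) - ∑ i ∈ K0, y i - k K0, fun _ => ⟨h0.2.2, fun h => absurd h hvh, ?_⟩⟩
      intro _ K hK hKc
      have h1 : ∑ i ∈ K0, y i + (k K0 : ℤ) = ∑ i ∈ K, y i + (k K : ℤ) :=
        hconst K0 hK0 hK0c K hK hKc
      have h2 := hk K hK hKc
      constructor <;> omega
  choose w hw using hT
  have hsumB : ∀ B ⊆ T, ∑ h ∈ B, x h = (∑ h ∈ B, (v (x h)).val) • b0 + (∑ h ∈ B, w h) • f1 := by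
    intro B hB
    rw [sum_congr rfl (fun h hh => (hw h (hB hh)).1), sum_add_distrib, sum_smul, sum_smul]
  have ind := block_ind m hm T (U \ F) hBc (fun h => (v (x h)).val) w y (m • b0) (m • f1)
    (by rw [← heXY]; exact hene) (by
      intro B hB I hI hne k hk α β hα hβ
      have hdis : Disjoint B I := disjoint_left.2 fun t ht htI => hTB t (hB.1 ht) (hI htI)
      have hs : ∑ i ∈ B ∪ I, x i = ((m:ℤ) * α) • b0 + ((m:ℤ) * β - k) • f1 := by
        rw [sum_union hdis, hsumB B hB.1, hsumI I hI, ← hα, ← hβ, natCast_zsmul, add_smul,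
          sub_smul, add_smul, add_smul]
        abel
      obtain ⟨t, ht, htB⟩ := exists_of_ssubset hB
      have h1 := (fillZ (B ∪ I) (by
        rw [ssubset_iff_of_subset (union_subset_union hB.1 hI)]
        refine ⟨t, mem_union_left _ ht, fun h => ?_⟩
        rcases mem_union.1 h with h | h
        · exact htB h
        · exact hTB t ht (hI h)) (hne.mono subset_union_right)
        (by rw [hs, map_add, map_zsmul, map_zsmul, hv0, hvb]; simp) k hk
        (by rw [hs, map_add, map_zsmul, map_zsmul, hu1]; simp)).1
      rw [hs, sub_smul, natCast_zsmul, heXY] at h1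
      rw [← h1, ← natCast_zsmul, ← natCast_zsmul, smul_smul, smul_smul, mul_comm α, mul_comm β]
      abel)
    (fun h _ => ZMod.val_lt _) hy1 (fun hY h hh => (hw h hh).2.2 hY)
  have hTz := (f.fr _).1 b.hz
  have hvT : m ∣ ∑ h ∈ T, (v (x h)).val := by
    rw [← ZMod.natCast_eq_zero_iff, Nat.cast_sum, sum_congr rfl (fun h _ => ZMod.natCast_zmod_val _),
      ← map_sum]
    exact hTz.2
  have hvg := ZMod.val_lt (v (x g))
  have hTg : T.erase g ⊂ T := erase_ssubset hg
  have indg : ∀ I ⊆ U \ F, #I = (v (x g)).val →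
      (m • f1 ≠ 0 → 1 ≤ ∑ h ∈ T.erase g, w h + ∑ i ∈ I, y i ∧
        ∑ h ∈ T.erase g, w h + ∑ i ∈ I, y i ≤ m) ∧
      (m • b0 ≠ 0 → ∑ h ∈ T, (v (x h)).val = m) := by
    intro I hI hIc
    have hs := add_sum_erase T (fun h => (v (x h)).val) hg
    have := ind (T.erase g) hTg I hI (card_pos.1 (by omega)) (by
      rw [hIc, add_comm, hs]; exact hvT)
    refine ⟨this.1, fun hX => ?_⟩
    have h1 := this.2 hX
    rw [hIc] at h1
    omega
  obtain ⟨I0, hI0, hI0c⟩ := exists_subset_card_eq (s := U \ F) (n := (v (x g)).val) (by omega)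
  have hX : m • b0 = 0 := by
    by_contra hX
    have h1 := (indg I0 hI0 hI0c).2 hX
    have : ∃ h ∈ T, (v (x h)).val = 0 := by
      by_contra hcon
      push Not at hcon
      have h2 := add_sum_erase T (fun h => (v (x h)).val) hg
      have h3 : #(T.erase g) • 1 ≤ ∑ h ∈ T.erase g, (v (x h)).val :=
        card_nsmul_le_sum _ _ 1 (fun h hh => Nat.pos_of_ne_zero (hcon h (mem_of_mem_erase hh)))
      rw [card_erase_of_mem hg, b.hc] at h3
      simp at h3
      omega
    obtain ⟨h, hh, hvh⟩ := this
    have := (hzero h hh hvh).2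
    rw [heXY] at this
    exact hX (by simpa using this)
  have hY : m • f1 ≠ 0 := by
    intro h; rw [heXY, hX, h] at hene; simp at hene
  have hwm : (m:ℤ) ∣ ∑ h ∈ T, w h := by
    rw [← ZMod.intCast_zmod_eq_zero_iff_dvd]
    have h1 := hTz.1
    rw [hsumB T Subset.rfl, map_add, map_zsmul, map_nsmul, hu1] at h1
    obtain ⟨q, hq⟩ := hvT
    rw [hq] at h1
    simpa using h1
  have hwT : ∑ h ∈ T, w h = m := by
    have h1 := (indg I0 hI0 hI0c).1 hY
    have h2 := (hw g hg).2.2 hY ((U \ F) \ I0) sdiff_subset (by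
      rw [card_sdiff_of_subset hI0, hBc, hI0c])
    have h3 := sum_sdiff hI0 (f := y)
    have h4 := add_sum_erase T w hg
    obtain ⟨q, hq⟩ := hwm
    have h5 : 0 < (m:ℤ) * q := by omega
    have h6 : (m:ℤ) * q < m * 2 := by omega
    have hmp : (0:ℤ) < m := by omega
    have h7 : 0 < q := pos_of_mul_pos_right h5 hmp.le
    have h8 := lt_of_mul_lt_mul_left h6 hmp.le
    have : q = 1 := by omega
    rw [hq, this, mul_one]
  have hw1 : ∀ h ∈ T, 1 ≤ w h := by
    intro h hh
    by_cases hvh : (v (x h)).val = 0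
    · rw [(hw h hh).2.1 hvh]
    · have : ∃ i ∈ U \ F, 1 ≤ y i := by
        by_contra hcon
        push Not at hcon
        have := sum_nonpos (s := U \ F) (f := y) (fun i hi => by have := hcon i hi; omega)
        omega
      obtain ⟨i, hi, hyi⟩ := this
      have h1 := add_sum_erase (U \ F) y hi
      obtain ⟨K, hK, hKc, hKs⟩ := sub_sum_nonpos y ((U \ F).erase i) (by omega)
        (m - (v (x h)).val) (by rw [card_erase_of_mem hi]; omega)
      have h2 := (hw h hh).2.2 hY K (hK.trans (erase_subset _ _)) hKc
      omega
  have hw2 : ∀ h ∈ T, w h = 1 := by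
    have h1 : ∑ h ∈ T, (w h - 1) = 0 := by
      rw [sum_sub_distrib, hwT, sum_const, b.hc]; simp
    have h2 := (sum_eq_zero_iff_of_nonneg (fun h hh => by have := hw1 h hh; omega)).1 h1
    intro h hh
    have := h2 h hh
    omega
  obtain ⟨j0, hj0, hyj, hyz⟩ := y_lemma y (U \ F) hy1 (m - (v (x g)).val) (by omega) (by omega) (by
    intro K hK hKc
    have := (hw g hg).2.2 hY K hK hKc
    rw [hw2 g hg] at this
    omega)
  refine ⟨f1, b0, j0, hj0, hf1, hY, hX, fun i hi hne => ?_, ?_, hu1, hv0, hvb, fun h hh => ?_⟩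
  · rw [hy i hi, hyz i hi hne]; simp
  · rw [hy j0 hj0, hyj]; simp
  · exact ⟨_, by rw [← one_zsmul f1, ← hw2 h hh]; exact (hw h hh).1⟩

end


theorem exists_le_of_le_map {α β : Type*} (f : α → β) (s : Multiset α) (T : Multiset β)
    (h : T ≤ s.map f) : ∃ t ≤ s, t.map f = T := by
  induction s using Quotient.inductionOn with
  | h l =>
    induction T using Quotient.inductionOn with
    | h l' =>
      have h : (l' : Multiset β) ≤ (l.map f : List β) := h
      rw [Multiset.coe_le] at h
      obtain ⟨l2, hp, hs⟩ := h
      obtain ⟨l3, h3, rfl⟩ := List.sublist_map_iff.1 hs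
      refine ⟨l3, Multiset.coe_le.2 h3.subperm, ?_⟩
      exact Quotient.sound hp

open Finset in
theorem exists_finset_of_le_map {α β : Type*} (f : α → β) (s : Finset α) (T : Multiset β)
    (h : T ≤ s.val.map f) : ∃ t ⊆ s, t.val.map f = T := by
  obtain ⟨t, ht, rfl⟩ := exists_le_of_le_map f s.val T h
  exact ⟨⟨t, Multiset.nodup_of_le ht s.nodup⟩, val_le_iff.1 ht, rfl⟩

section
variable {G ι : Type*} [AddCommGroup G] [Fintype ι] [DecidableEq ι]
  {m n : ℕ} {x : ι → G} {H : AddSubgroup G}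

open Finset in
theorem Ctx.frame (c : Ctx m n x H) (hB : PropertyB m) (U : Finset ι) (hUc : #U = 2 * m - 1)
    (hUz : ∑ i ∈ U, x i ∈ H) (hmin : ∀ J ⊆ U, J.Nonempty → J ≠ U → ∑ i ∈ J, x i ∉ H) :
    ∃ F u v, Fr m x H U F u v := by
  have hm := c.hm
  have : NeZero m := ⟨by omega⟩
  obtain ⟨u0, v0, hf⟩ := c.hfr
  let φ : G →+ ZMod m × ZMod m := u0.prod v0
  have hφ : ∀ g, g ∈ H ↔ φ g = 0 := by
    intro g; rw [hf]; simp [φ, Prod.ext_iff]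
  have hmin' : ∀ J ⊆ U, J.Nonempty → J ≠ U → ∑ i ∈ J, φ (x i) ≠ 0 := by
    intro J h1 h2 h3 h4
    exact hmin J h1 h2 h3 ((hφ _).2 (by rw [map_sum, h4]))
  have hz' : ∑ i ∈ U, φ (x i) = 0 := by rw [← map_sum]; exact (hφ _).1 hUz
  obtain ⟨g, hg⟩ := hB (U.val.map (fun i => φ (x i))) ⟨by
      rw [← Multiset.card_pos, Multiset.card_map, card_val]; omega, hz', by
      intro T hT h0 hne hs
      obtain ⟨t, ht, rfl⟩ := exists_finset_of_le_map _ _ _ hT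
      refine hmin' t ht ?_ ?_ hs
      · rw [nonempty_iff_ne_empty]; rintro rfl; simp at h0
      · rintro rfl; exact hne rfl⟩ (by rw [Multiset.card_map, card_val, hUc])
  rw [Multiset.count_map, ← filter_val, card_val] at hg
  obtain ⟨F, hF, hFc⟩ := exists_subset_card_eq hg
  have hFU : F ⊆ U := hF.trans (filter_subset _ _)
  have hFg : ∀ i ∈ F, φ (x i) = g := fun i hi => (mem_filter.1 (hF hi)).2.symm
  have hmg : m • g = 0 := by
    ext <;> simp
  have hord : addOrderOf g = m := by
    have h1 := addOrderOf_dvd_of_nsmul_eq_zero hmg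
    have h2 := Nat.le_of_dvd (by omega) h1
    have h3 := Nat.pos_of_dvd_of_pos h1 (by omega)
    by_contra hne
    obtain ⟨F', hF', hF'c⟩ := exists_subset_card_eq (s := F) (n := addOrderOf g) (by omega)
    refine hmin' F' (hF'.trans hFU) (card_pos.1 (by omega)) ?_ ?_
    · rintro rfl; omega
    · rw [sum_congr rfl (fun i hi => hFg i (hF' hi)), sum_const, hF'c, addOrderOf_nsmul_eq_zero]
  have hBc : #(U \ F) = m := by rw [card_sdiff_of_subset hFU, hUc, hFc]; omega
  obtain ⟨q1, q2⟩ := quot_lemma (fun i => φ (x i)) U F hFU g hFg (by rw [hFc, hord]) m hBc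
    (by rw [hord, Nat.card_prod, Nat.card_zmod]) hz' hmin'
  obtain ⟨i1, hi1⟩ := card_pos.1 (show 0 < #(U \ F) by omega)
  set p := φ (x i1) with hp
  let Θ : (ZMod m × ZMod m) →ₗ[ZMod m] (ZMod m × ZMod m) :=
    (LinearMap.toSpanSingleton (ZMod m) _ g).coprod (LinearMap.toSpanSingleton (ZMod m) _ p)
  have hΘ : ∀ a b, Θ (a, b) = a • g + b • p := fun a b => by simp [Θ]
  have hcast : ∀ (a : ZMod m) (g : ZMod m × ZMod m), a • g = (a.val : ℤ) • g := by
    intro a g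
    rw [natCast_zsmul]
    conv_lhs => rw [← ZMod.natCast_zmod_val a]
    rw [Nat.cast_smul_eq_nsmul]
  have hinj : Function.Injective Θ := by
    rw [injective_iff_map_eq_zero]
    rintro ⟨a, b⟩ h
    rw [hΘ] at h
    have h1 : (b.val : ℤ) • p ∈ AddSubgroup.zmultiples g := by
      rw [AddSubgroup.mem_zmultiples_iff]
      refine ⟨-(a.val : ℤ), ?_⟩
      rw [neg_smul, ← hcast, ← hcast]
      exact neg_eq_of_add_eq_zero_right h
    have h2 := (q2 i1 hi1 _).1 h1
    have hb : b = 0 := by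
      have := (ZMod.intCast_zmod_eq_zero_iff_dvd _ m).2 h2
      simpa using this
    rw [hb, zero_smul, add_zero, hcast, natCast_zsmul] at h
    have h3 := addOrderOf_dvd_of_nsmul_eq_zero h
    rw [hord] at h3
    have h4 := (ZMod.natCast_eq_zero_iff _ m).2 h3
    have ha : a = 0 := by simpa using h4
    rw [ha, hb]; rfl
  have hbij : Function.Bijective Θ := Finite.injective_iff_bijective.1 hinj
  let Ψ := LinearEquiv.ofBijective Θ hbij
  have hΨ : ∀ a b, Ψ.symm (a • g + b • p) = (a, b) := by
    intro a b
    rw [LinearEquiv.symm_apply_eq]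
    exact (hΘ a b).symm
  let χ : G →+ ZMod m × ZMod m := (Ψ.symm.toLinearMap.toAddMonoidHom).comp φ
  have hχ : ∀ g, χ g = Ψ.symm (φ g) := fun _ => rfl
  refine ⟨F, (AddMonoidHom.fst _ _).comp χ, (AddMonoidHom.snd _ _).comp χ,
    ⟨?_, hUc, hUz, hFU, hFc, ?_, ?_, ?_⟩⟩
  · intro g
    rw [hφ]
    have : φ g = 0 ↔ χ g = 0 := by rw [hχ]; simp
    rw [this]; simp [Prod.ext_iff]
  · intro i hi
    have := hΨ 1 0
    simp only [AddMonoidHom.comp_apply, hχ, hFg i hi]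
    simp at this
    simp [this]
  · intro i hi
    have := hΨ 1 0
    simp only [AddMonoidHom.comp_apply, hχ, hFg i hi]
    simp at this
    simp [this]
  · intro i hi
    obtain ⟨k, hk⟩ := AddSubgroup.mem_zmultiples_iff.1 (q1 i hi i1 hi1)
    have h1 : φ (x i) = (k : ZMod m) • g + (1 : ZMod m) • p := by
      rw [Int.cast_smul_eq_zsmul, hk, one_smul]; simp [hp]
    simp only [AddMonoidHom.comp_apply, hχ, h1, hΨ]
    rfl

open Finset in
theorem Ctx.good_frame (c : Ctx m n x H) (hB : PropertyB m) :
    ∃ u v : G →+ ZMod m, (∀ g, g ∈ H ↔ u g = 0 ∧ v g = 0) ∧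
      (∀ i, v (x i) = 1 ∨ (u (x i) = 1 ∧ v (x i) = 0)) ∧
      ∃ q, 1 ≤ q ∧ q ≤ n ∧ #(univ.filter fun i => v (x i) = 1) = q * m := by
  have hm := c.hm
  have : NeZero m := ⟨by omega⟩
  have : Fact (1 < m) := ⟨by omega⟩
  obtain ⟨P, U, hP, hU, hPc, hPn, hUc, hUz, hmin, hgood⟩ := c.decomp
  obtain ⟨F, u, v, f⟩ := c.frame hB U hUc hUz hmin
  have hdis : ∀ T ∈ P, Disjoint T U := by
    intro T hT
    rw [disjoint_left]
    intro i hi hiU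
    rw [hU, mem_compl] at hiU
    exact hiU (mem_biUnion.2 ⟨T, hT, hi⟩)
  have hblk : 2 ≤ n → ∀ T ∈ P, Blk m n x H U T := fun h2 T hT =>
    ⟨hdis T hT, hPc T hT, (hP.1 T hT).2.2, hgood h2 T hT⟩
  have hn2 : ∀ T ∈ P, 2 ≤ n := by
    intro T hT
    have := card_pos.2 ⟨T, hT⟩
    omega
  have hfr : ∃ F u v, Fr m x H U F u v ∧ ∀ T ∈ P, ∀ g ∈ T, v (x g) = 0 ∨ v (x g) = 1 := by
    by_cases hbad : ∀ T ∈ P, ∀ g ∈ T, v (x g) = 0 ∨ v (x g) = 1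
    · exact ⟨F, u, v, f, hbad⟩
    push Not at hbad
    obtain ⟨T, hT, g, hg, hg0, hg1⟩ := hbad
    obtain ⟨f1, b0, j0, hj0, hf1, hY, hX, hE, hxj, huf, hvf, hvb, -⟩ :=
      f.bad c (hn2 T hT) (hblk (hn2 T hT) T hT) hg hg0 hg1
    have hf' : Fr m x H U ((U \ F).erase j0) v (u - (AddMonoidHom.mulLeft (u b0)).comp v) := by
      have hmemE : ∀ i ∈ (U \ F).erase j0, x i = b0 := fun i hi =>
        hE i (mem_of_mem_erase hi) (ne_of_mem_erase hi)
      refine ⟨?_, hUc, hUz, (erase_subset _ _).trans sdiff_subset, ?_, ?_, ?_, ?_⟩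
      · intro g
        rw [f.fr]
        simp only [AddMonoidHom.sub_apply, AddMonoidHom.comp_apply, AddMonoidHom.coe_mulLeft]
        constructor
        · rintro ⟨h1, h2⟩; simp [h1, h2]
        · rintro ⟨h1, h2⟩; simp [h1] at h2; exact ⟨h2, h1⟩
      · rw [card_erase_of_mem hj0, f.cardB c]
      · intro i hi; rw [hmemE i hi, hvb]
      · intro i hi; rw [hmemE i hi]
        simp [hvb]
      · intro i hi
        rw [mem_sdiff, mem_erase, mem_sdiff] at hi
        by_cases hij : i = j0
        · rw [hij, hxj]
          simp [hvb, huf, hvf]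
        · have hiF : i ∈ F := by
            by_contra h; exact hi.2 ⟨hij, hi.1, h⟩
          rw [hf1 i hiF]
          simp [huf, hvf]
    refine ⟨_, _, _, hf', ?_⟩
    by_contra hbad
    push Not at hbad
    obtain ⟨T', hT', g', hg', hg0', hg1'⟩ := hbad
    obtain ⟨f1', b0', j0', hj0', hf1', hY', -⟩ :=
      hf'.bad c (hn2 T' hT') (hblk (hn2 T' hT') T' hT') hg' hg0' hg1'
    obtain ⟨i, hi⟩ := card_pos.1 (show 0 < #((U \ F).erase j0) by
      rw [card_erase_of_mem hj0, f.cardB c]; omega)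
    apply hY'
    rw [← hf1' i hi, hE i (mem_of_mem_erase hi) (ne_of_mem_erase hi), hX]
  clear f
  obtain ⟨F, u, v, f, hok⟩ := hfr
  have hzero : ∀ T ∈ P, ∀ h ∈ T, v (x h) = 0 → u (x h) = 1 := by
    intro T hT h hh hvx
    have h2 := ZMod.val_lt (-(u (x h)))
    obtain ⟨F', hF', hF'c⟩ := exists_subset_card_eq (s := F) (n := (-(u (x h))).val)
      (by rw [f.hFc]; omega)
    have hnot : h ∉ F' := fun hh' => disjoint_left.1 (hdis T hT) hh (f.hFU (hF' hh'))
    have h1 := c.le_card (insert_nonempty h F') (by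
      rw [f.fr, sum_insert hnot, map_add, map_add, hvx, map_sum, map_sum,
        sum_congr rfl (fun i hi => f.hF1 i (hF' hi)),
        sum_congr rfl (fun i hi => f.hF0 i (hF' hi))]
      simp [hF'c])
    rw [card_insert_of_notMem hnot, hF'c] at h1
    have h3 : (-(u (x h))).val = m - 1 := by omega
    have h4 := ZMod.natCast_zmod_val (-(u (x h)))
    rw [h3, Nat.cast_sub (by omega)] at h4
    simp at h4
    exact h4.symm
  have hcov : ∀ i, i ∈ U ∨ ∃ T ∈ P, i ∈ T := by
    intro i
    by_cases hi : i ∈ U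
    · exact Or.inl hi
    · rw [hU, mem_compl, not_not] at hi
      obtain ⟨T, hT, hiT⟩ := mem_biUnion.1 hi
      exact Or.inr ⟨T, hT, hiT⟩
  refine ⟨u, v, f.fr, ?_, ?_⟩
  · intro i
    rcases hcov i with hi | ⟨T, hT, hi⟩
    · by_cases hiF : i ∈ F
      · exact Or.inr ⟨f.hF1 i hiF, f.hF0 i hiF⟩
      · exact Or.inl (f.hB i (mem_sdiff.2 ⟨hi, hiF⟩))
    · rcases hok T hT i hi with h | h
      · exact Or.inr ⟨hzero T hT i hi h, h⟩
      · exact Or.inl h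
  · have hd : m ∣ #(univ.filter fun i => v (x i) = 1) := by
      have h1 : ∀ T ∈ P, m ∣ #(T.filter fun i => v (x i) = 1) := by
        intro T hT
        have hz := ((f.fr _).1 (hP.1 T hT).2.2).2
        rw [map_sum, sum_congr rfl (fun i hi => by
          rcases hok T hT i hi with h | h <;> simp [h] :
          ∀ i ∈ T, v (x i) = if v (x i) = 1 then 1 else 0), sum_boole] at hz
        exact (ZMod.natCast_eq_zero_iff _ m).1 hz
      have h2 : (univ.filter fun i => v (x i) = 1) =
          (U \ F) ∪ (P.biUnion id).filter fun i => v (x i) = 1 := by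
        ext i
        simp only [mem_filter, mem_univ, true_and, mem_union]
        constructor
        · intro h
          by_cases hi : i ∈ U
          · left
            refine mem_sdiff.2 ⟨hi, fun hF => ?_⟩
            rw [f.hF0 i hF] at h
            simp at h
          · rw [hU, mem_compl, not_not] at hi
            exact Or.inr ⟨hi, h⟩
        · rintro (h | h)
          · exact f.hB i h
          · exact h.2
      rw [h2, card_union_of_disjoint, f.cardB c, filter_biUnion, card_biUnion]
      · exact dvd_add dvd_rfl (dvd_sum fun T hT => h1 T hT)
      · intro T hT T' hT' hne
        exact disjoint_filter_filter (hP.2 hT hT' hne)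
      · rw [disjoint_left]
        intro i hi hi'
        have := (mem_sdiff.1 hi).1
        rw [hU, mem_compl] at this
        exact this (mem_filter.1 hi').1
    obtain ⟨q, hq⟩ := hd
    have hge : m ≤ #(univ.filter fun i => v (x i) = 1) := by
      refine (f.cardB c).ge.trans ?_
      apply card_le_card
      intro i hi
      simpa using f.hB i hi
    have hle : #(univ.filter fun i => v (x i) = 1) + #F ≤ #(univ : Finset ι) := by
      rw [← card_union_of_disjoint]
      · exact card_le_card (subset_univ _)
      · rw [disjoint_left]
        intro i hi hF
        have := (mem_filter.1 hi).2
        rw [f.hF0 i hF] at this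
        simp at this
    rw [card_univ, c.card, f.hFc, hq] at hle
    rw [hq] at hge
    refine ⟨q, ?_, ?_, by rw [hq, mul_comm]⟩
    · rcases Nat.eq_zero_or_pos q with h | h
      · rw [h] at hge; omega
      · exact h
    · have : m * q ≤ m * n := by omega
      exact Nat.le_of_mul_le_mul_left this (by omega)

end


/-- The two normal forms. -/
def Concl {G : Type*} [AddCommGroup G] (m n : ℕ) (S : Multiset G) : Prop :=
    (∃ e1 e2 ej ek : G, IsBasisPair e1 e2 ∧ addOrderOf e2 = m * n ∧
      ((ej, ek) = (e1, e2) ∨ (ej, ek) = (e2, e1)) ∧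
      ∃ x : Fin (addOrderOf ek) → ℕ,
        ((∑ i, (x i : ℤ)) ≡ -1 [ZMOD (addOrderOf ej)]) ∧
        S = Multiset.replicate (addOrderOf ej - 1) ej +
          Multiset.map (fun i => -(x i : ℤ) • ej + ek) Finset.univ.val) ∨
    (∃ s : ℕ, 1 ≤ s ∧ s ≤ n ∧ ∃ g1 g2 : G,
      AddSubgroup.closure {g1, g2} = ⊤ ∧ addOrderOf g2 = m * n ∧
      (s ≠ 1 → m • g1 = m • g2) ∧
      ∃ x : Fin ((n + 1 - s) * m) → ℕ, (∑ i, x i) = m - 1 ∧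
        S = Multiset.replicate (s * m - 1) g1 +
          Multiset.map (fun i => -(x i : ℤ) • g1 + g2) Finset.univ.val)

section
variable {G ι : Type*} [AddCommGroup G] [Fintype ι] [DecidableEq ι]
  {m n : ℕ} {x : ι → G} {H : AddSubgroup G}

open Finset in
theorem to_form (x : ι → G) (Hs Bs : Finset ι) (hU : Hsᶜ = Bs) (a N : ℕ) (ha : #Hs = a)
    (hN : #Bs = N) (ej ek : G) (hx : ∀ i ∈ Hs, x i = ej) (z : ι → ℕ)
    (hz : ∀ i ∈ Bs, x i = -(z i : ℤ) • ej + ek) :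
    ∃ xx : Fin N → ℕ, ∑ i, xx i = ∑ i ∈ Bs, z i ∧
      (univ.val.map x) = Multiset.replicate a ej +
        Multiset.map (fun i => -(xx i : ℤ) • ej + ek) univ.val := by
  subst hN
  let φ := Bs.equivFin
  refine ⟨fun t => z (φ.symm t), ?_, ?_⟩
  · rw [Equiv.sum_comp φ.symm (fun b : Bs => z b), sum_coe_sort]
  · have h1 : (univ : Finset ι).val = Hs.val + Bs.val := by
      have hd : Disjoint Hs Bs := hU ▸ disjoint_compl_right
      rw [← union_compl Hs, hU, ← disjUnion_eq_union _ _ hd]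
      rfl
    rw [h1, Multiset.map_add]
    congr 1
    · rw [← ha, Multiset.eq_replicate]
      refine ⟨by simp, ?_⟩
      intro b hb
      obtain ⟨i, hi, rfl⟩ := Multiset.mem_map.1 hb
      exact hx i hi
    · rw [Multiset.map_congr rfl hz]
      have h2 : Bs.val = (univ : Finset (Fin #Bs)).val.map (fun t => (φ.symm t : ι)) := by
        have : Bs = (univ : Finset (Fin #Bs)).map
            (φ.symm.toEmbedding.trans (Function.Embedding.subtype _)) := by
          ext i
          simp only [mem_map, mem_univ, true_and, Function.Embedding.trans_apply]
          constructor
          · intro hi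
            exact ⟨φ ⟨i, hi⟩, by simp⟩
          · rintro ⟨t, rfl⟩
            exact (φ.symm t).2
        conv_lhs => rw [this]
        rfl
      conv_lhs => rw [h2]
      rw [Multiset.map_map]
      rfl

theorem basis_lemma [Finite G] (h b : G) (L : ℕ) (hcard : Nat.card G = addOrderOf h * L)
    (hk : ∀ k : ℤ, k • b ∈ AddSubgroup.zmultiples h ↔ (L : ℤ) ∣ k) (hL : L • b = 0) :
    IsBasisPair h b ∧ IsBasisPair b h ∧ addOrderOf b = L := by
  have hord : 0 < addOrderOf h := addOrderOf_pos h
  have hLpos : 0 < L := by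
    rcases Nat.eq_zero_or_pos L with h | h
    · rw [h, mul_zero] at hcard
      have := Nat.card_pos (α := G)
      omega
    · exact h
  have hob : addOrderOf b = L := by
    apply Nat.dvd_antisymm (addOrderOf_dvd_of_nsmul_eq_zero hL)
    have := (hk (addOrderOf b)).1 (by
      rw [natCast_zsmul, addOrderOf_nsmul_eq_zero]; exact zero_mem _)
    exact_mod_cast this
  have hcl : AddSubgroup.closure {h, b} = ⊤ := by
    rw [eq_top_iff]
    intro g _
    let Q := G ⧸ AddSubgroup.zmultiples h
    have hq : Nat.card Q = L := by
      have := AddSubgroup.card_eq_card_quotient_mul_card_addSubgroup (AddSubgroup.zmultiples h)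
      rw [Nat.card_zmultiples, hcard, mul_comm] at this
      exact (Nat.eq_of_mul_eq_mul_right hord this).symm
    have hordq : addOrderOf (b : Q) = L := by
      apply Nat.dvd_antisymm
      · apply addOrderOf_dvd_of_nsmul_eq_zero
        rw [← QuotientAddGroup.mk_nsmul, hL]; rfl
      · have := (hk (addOrderOf (b : Q))).1 (by
          rw [natCast_zsmul, ← QuotientAddGroup.eq_zero_iff, QuotientAddGroup.mk_nsmul,
            addOrderOf_nsmul_eq_zero])
        exact_mod_cast this
    have htop : AddSubgroup.zmultiples (b : Q) = ⊤ := by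
      apply AddSubgroup.eq_top_of_card_eq
      rw [Nat.card_zmultiples, hordq, hq]
    have hg : (g : Q) ∈ AddSubgroup.zmultiples (b : Q) := htop ▸ AddSubgroup.mem_top _
    obtain ⟨k, hk⟩ := AddSubgroup.mem_zmultiples_iff.1 hg
    rw [← QuotientAddGroup.mk_zsmul, ← sub_eq_zero, ← QuotientAddGroup.mk_sub,
      QuotientAddGroup.eq_zero_iff] at hk
    obtain ⟨l, hl⟩ := AddSubgroup.mem_zmultiples_iff.1 hk
    have : g = k • b - l • h := by rw [hl]; abel
    rw [this]
    exact sub_mem (zsmul_mem (AddSubgroup.subset_closure (by simp)) _)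
      (zsmul_mem (AddSubgroup.subset_closure (by simp)) _)
  have hind : ∀ a c : ℤ, a • h + c • b = 0 → a • h = 0 ∧ c • b = 0 := by
    intro a c hac
    have h1 : c • b ∈ AddSubgroup.zmultiples h := by
      rw [AddSubgroup.mem_zmultiples_iff]
      refine ⟨-a, ?_⟩
      rw [neg_smul]
      exact neg_eq_of_add_eq_zero_right hac
    obtain ⟨q, hq⟩ := (hk c).1 h1
    have h2 : c • b = 0 := by
      rw [hq, mul_comm, mul_smul, natCast_zsmul, hL, smul_zero]
    exact ⟨by simpa [h2] using hac, h2⟩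
  refine ⟨⟨hcl, hind⟩, ⟨by rw [Set.pair_comm]; exact hcl, ?_⟩, hob⟩
  intro a c hac
  exact (hind c a (by rw [add_comm]; exact hac)).symm

open Finset in
theorem form1 [Finite G] (x : ι → G) (sum0 : ∑ i, x i = 0) (Hs Bs : Finset ι) (hU : Hsᶜ = Bs)
    (ej ek : G) (ha : #Hs = addOrderOf ej - 1) (hN : #Bs = addOrderOf ek)
    (hx : ∀ i ∈ Hs, x i = ej) (hb : ∀ i ∈ Bs, x i - ek ∈ AddSubgroup.zmultiples ej) :
    ∃ xx : Fin (addOrderOf ek) → ℕ, ((∑ i, (xx i : ℤ)) ≡ -1 [ZMOD (addOrderOf ej)]) ∧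
        univ.val.map x = Multiset.replicate (addOrderOf ej - 1) ej +
          Multiset.map (fun i => -(xx i : ℤ) • ej + ek) Finset.univ.val := by
  have hord : 0 < addOrderOf ej := addOrderOf_pos ej
  have : ∀ i, ∃ z : ℕ, i ∈ Bs → x i = -(z : ℤ) • ej + ek := by
    intro i
    by_cases hi : i ∈ Bs
    · obtain ⟨k, hk⟩ := AddSubgroup.mem_zmultiples_iff.1 (hb i hi)
      have hmod := Int.emod_nonneg (-k) (show (addOrderOf ej : ℤ) ≠ 0 by positivity)
      refine ⟨((-k) % (addOrderOf ej)).toNat, fun _ => ?_⟩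
      rw [Int.toNat_of_nonneg hmod, neg_smul, mod_addOrderOf_zsmul, neg_smul, neg_neg, hk]
      abel
    · exact ⟨0, fun h => absurd h hi⟩
  choose z hz using this
  obtain ⟨xx, h1, h2⟩ := to_form x Hs Bs hU _ _ ha hN ej ek hx z hz
  refine ⟨xx, ?_, h2⟩
  have h3 : ((∑ i ∈ Bs, z i : ℕ) : ℤ) = ∑ i, (xx i : ℤ) := by rw [← h1]; push_cast; rfl
  rw [← h3]
  have h4 := sum_add_sum_compl Hs x
  rw [sum0, hU, sum_congr rfl hx, sum_congr rfl hz, sum_add_distrib, sum_const, sum_const, ha, hN,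
    addOrderOf_nsmul_eq_zero, add_zero, ← sum_smul, sum_neg_distrib] at h4
  have h5 : (1 + ((∑ i ∈ Bs, z i : ℕ) : ℤ)) • ej = 0 := by
    have h6 : (addOrderOf ej - 1) • ej = - ej := by
      have := addOrderOf_nsmul_eq_zero ej
      rw [← Nat.sub_add_cancel hord, succ_nsmul] at this
      exact eq_neg_of_add_eq_zero_left (by simpa using this)
    rw [h6, neg_smul] at h4
    push_cast
    rw [add_smul, one_smul]
    rw [← neg_eq_zero, neg_add]
    exact h4
  have h7 := addOrderOf_dvd_iff_zsmul_eq_zero.2 h5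
  rw [Int.modEq_iff_dvd]
  have : (-1 - ((∑ i ∈ Bs, z i : ℕ) : ℤ)) = -(1 + ((∑ i ∈ Bs, z i : ℕ) : ℤ)) := by ring
  rw [this, dvd_neg]
  exact h7

open Finset in
theorem Ctx.constHs (c : Ctx m n x H) (hn : 2 ≤ n) {u v : G →+ ZMod m}
    (hfr : ∀ g, g ∈ H ↔ u g = 0 ∧ v g = 0) (Hs : Finset ι)
    (hHs : ∀ i ∈ Hs, u (x i) = 1 ∧ v (x i) = 0) (hc : m + 1 ≤ #Hs) :
    ∀ i ∈ Hs, ∀ j ∈ Hs, x i = x j := by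
  have hm := c.hm
  intro i hi i0 hi0
  by_cases hii : i = i0
  · rw [hii]
  obtain ⟨R, hR, hRc⟩ := exists_subset_card_eq (s := (Hs.erase i).erase i0) (n := m - 1) (by
    rw [card_erase_of_mem (mem_erase.2 ⟨Ne.symm hii, hi0⟩), card_erase_of_mem hi]; omega)
  have hiR : i ∉ R := fun h => by simpa using hR h
  have hi0R : i0 ∉ R := fun h => by simpa using hR h
  have hRB : R ⊆ Hs := fun a ha => mem_of_mem_erase (mem_of_mem_erase (hR ha))
  have hz : ∀ J ⊆ Hs, #J = m → ∑ i ∈ J, x i ∈ H := by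
    intro J hJ hJc
    rw [hfr, map_sum, map_sum, sum_congr rfl (fun i hi => (hHs i (hJ hi)).1),
      sum_congr rfl (fun i hi => (hHs i (hJ hi)).2)]
    simp [hJc]
  have hK : Good n x H (insert i (insert i0 R)) := c.good_of_card hn (by
    have h1 := card_insert_le i (insert i0 R)
    have h2 := card_insert_le i0 R
    omega)
  have h1 : insert i R ⊂ insert i (insert i0 R) := by
    rw [ssubset_iff_of_subset (insert_subset_insert _ (subset_insert _ _))]
    refine ⟨i0, by simp, ?_⟩
    rw [mem_insert]; rintro (h | h)
    · exact hii h.symm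
    · exact hi0R h
  have h2 : insert i0 R ⊂ insert i (insert i0 R) := by
    apply ssubset_insert
    rw [mem_insert]; rintro (h | h)
    · exact hii h
    · exact hiR h
  have h3 := (c.good_sum hn hK (insert_nonempty i R) h1 (hz _ (insert_subset hi hRB) (by
    rw [card_insert_of_notMem hiR]; omega))).2 _ (insert_nonempty i0 R) h2
    (hz _ (insert_subset hi0 hRB) (by rw [card_insert_of_notMem hi0R]; omega))
  rw [sum_insert hiR, sum_insert hi0R] at h3
  exact (add_right_cancel h3).symm

open Finset in
/-- The case of exactly `m` elements off the line. -/
theorem Ctx.case1 (c : Ctx m n x H) {u v : G →+ ZMod m}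
    (hfr : ∀ g, g ∈ H ↔ u g = 0 ∧ v g = 0)
    (hd : ∀ i, v (x i) = 1 ∨ (u (x i) = 1 ∧ v (x i) = 0))
    (hq : #(univ.filter fun i => v (x i) = 1) = m) : Concl m n (univ.val.map x) := by
  have hm := c.hm
  have hn := c.hn
  have hmn : m * 1 ≤ m * n := Nat.mul_le_mul_left _ hn
  have : NeZero m := ⟨by omega⟩
  have : Finite G := Nat.finite_of_card_ne_zero (by
    rw [c.hG]; have := Nat.mul_pos (Nat.mul_pos (show 0 < m by omega) (show 0 < m by omega)) hn
    omega)
  set Bs := univ.filter fun i => v (x i) = 1 with hBs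
  have hHsc : #Bsᶜ = m * n - 1 := by rw [card_compl, hq, c.card]; omega
  have hHs : ∀ i ∈ Bsᶜ, u (x i) = 1 ∧ v (x i) = 0 := by
    intro i hi
    rcases hd i with h | h
    · exfalso; simp [hBs] at hi; exact hi h
    · exact h
  have hconst : ∀ i ∈ Bsᶜ, ∀ j ∈ Bsᶜ, x i = x j := by
    rcases Nat.lt_or_ge n 2 with h | h
    · have hn1 : Nat.card H = 1 := by rw [c.hH]; omega
      have hbot : H = ⊥ := AddSubgroup.card_eq_one.1 hn1
      intro i hi j hj
      have : x i - x j ∈ H := by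
        rw [hfr, map_sub, map_sub, (hHs i hi).1, (hHs i hi).2, (hHs j hj).1, (hHs j hj).2]
        simp
      rw [hbot, AddSubgroup.mem_bot, sub_eq_zero] at this
      exact this
    · apply c.constHs h hfr Bsᶜ hHs
      have : m * 2 ≤ m * n := Nat.mul_le_mul_left _ h
      omega
  obtain ⟨i0, hi0⟩ := card_pos.1 (show 0 < #Bsᶜ by omega)
  set h1 := x i0 with hh1
  have hx : ∀ i ∈ Bsᶜ, x i = h1 := fun i hi => hconst i hi i0 hi0
  have hord : addOrderOf h1 = m * n := by
    have h2 := addOrderOf_dvd_of_nsmul_eq_zero (c.hexp h1)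
    have h3 := Nat.le_of_dvd (by omega) h2
    have h4 := addOrderOf_pos h1
    by_contra hne
    obtain ⟨F', hF', hF'c⟩ := exists_subset_card_eq (s := Bsᶜ) (n := addOrderOf h1) (by omega)
    refine c.min F' (card_pos.1 (by omega)) ?_ ?_
    · rintro rfl
      have := card_le_card hF'
      rw [card_univ, c.card] at this
      omega
    · rw [sum_congr rfl (fun i hi => hx i (hF' hi)), sum_const, hF'c, addOrderOf_nsmul_eq_zero]
  have hUB : (univ : Finset ι) \ Bsᶜ = Bs := by rw [← compl_eq_univ_sdiff, compl_compl]
  obtain ⟨q1, q2⟩ := quot_lemma x univ Bsᶜ (subset_univ _) h1 hx (by rw [hHsc, hord]) m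
    (by rw [hUB, hq]) (by rw [hord, c.hG]; ring) c.sum0 (fun t _ h1 h2 => c.min t h1 h2)
  rw [hUB] at q1 q2
  obtain ⟨i1, hi1⟩ := card_pos.1 (show 0 < #Bs by omega)
  obtain ⟨k, hk⟩ := AddSubgroup.mem_zmultiples_iff.1 ((q2 i1 hi1 m).2 dvd_rfl)
  have hmk : (m : ℤ) ∣ k := by
    have h2 : ((n:ℤ) * k) • h1 = 0 := by
      rw [mul_smul, hk, smul_smul, mul_comm (n:ℤ), ← Nat.cast_mul, natCast_zsmul, c.hexp]
    have h3 := addOrderOf_dvd_iff_zsmul_eq_zero.2 h2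
    rw [hord, Nat.cast_mul, mul_comm (m:ℤ)] at h3
    exact Int.dvd_of_mul_dvd_mul_left (by positivity) h3
  obtain ⟨l, hl⟩ := hmk
  set e1 := x i1 - l • h1 with he1
  have hme : m • e1 = 0 := by
    rw [he1, smul_sub, ← natCast_zsmul, ← hk, hl, ← natCast_zsmul, smul_smul, sub_self]
  have hke : ∀ k : ℤ, k • e1 ∈ AddSubgroup.zmultiples h1 ↔ (m : ℤ) ∣ k := by
    intro k
    rw [← q2 i1 hi1 k, he1, smul_sub, smul_smul]
    rw [sub_eq_add_neg]; exact AddSubgroup.add_mem_cancel_right _ (neg_mem (AddSubgroup.zsmul_mem_zmultiples _ _))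
  obtain ⟨hb1, hb2, hoe⟩ := basis_lemma h1 e1 m (by rw [hord, c.hG]; ring) hke hme
  left
  refine ⟨e1, h1, h1, e1, hb2, hord, Or.inr rfl, ?_⟩
  apply form1 x c.sum0 Bsᶜ Bs (compl_compl _) h1 e1 (by rw [hHsc, hord]) (by rw [hq, hoe]) hx
  intro i hi
  have h2 : x i - e1 = (x i - x i1) + l • h1 := by rw [he1]; abel
  rw [h2]
  exact add_mem (q1 i hi i1 hi1) (AddSubgroup.zsmul_mem_zmultiples _ _)

end


section
open Finset

/-- If all `m`-subset sums of an integer family differ by less than `m`, then some value is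
attained more than `m` times. -/
theorem mode_lemma {ι : Type*} [DecidableEq ι] (B : Finset ι) (y : ι → ℤ) (m : ℕ) (hm : 1 ≤ m)
    (hB : 2 * m ≤ #B)
    (h : ∀ I ⊆ B, #I = m → ∀ I' ⊆ B, #I' = m → ∑ i ∈ I', y i - ∑ i ∈ I, y i ≤ m - 1) :
    ∃ t, m + 1 ≤ #(B.filter fun i => y i = t) := by
  obtain ⟨A, hA, hmin⟩ := exists_min_image (powersetCard m B) (fun I => ∑ i ∈ I, y i)
    (powersetCard_nonempty.2 (by omega))
  rw [mem_powersetCard] at hA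
  obtain ⟨hAB, hAc⟩ := hA
  obtain ⟨a, haA, hmax⟩ := exists_max_image A y (card_pos.1 (by omega))
  set t := y a with ht
  have hge : ∀ j ∈ B, j ∉ A → t ≤ y j := by
    intro j hj hjA
    have hjA' : j ∉ A.erase a := fun h => hjA (mem_of_mem_erase h)
    have h1 := hmin (insert j (A.erase a)) (mem_powersetCard.2
      ⟨insert_subset hj ((erase_subset _ _).trans hAB), by
        rw [card_insert_of_notMem hjA', card_erase_of_mem haA]; omega⟩)
    simp only [sum_insert hjA'] at h1
    rw [← add_sum_erase A y haA] at h1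
    omega
  refine ⟨t, ?_⟩
  set Q := (B \ A).filter fun i => t < y i with hQ
  set P := A.filter fun i => y i < t with hP
  have hBA : #(B \ A) = #B - m := by rw [card_sdiff_of_subset hAB, hAc]
  have hlowA : ∑ i ∈ A, y i ≤ m * t - #P := by
    have : ∑ i ∈ A, y i ≤ ∑ i ∈ A, (t - if y i < t then 1 else 0) := by
      apply sum_le_sum
      intro i hi
      have := hmax i hi
      split_ifs <;> omega
    rw [sum_sub_distrib, sum_const, sum_boole, hAc] at this
    simpa using this
  have hup : ∀ A' ⊆ B \ A, #A' = m → m * t + #(A'.filter fun i => t < y i) ≤ ∑ i ∈ A', y i := by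
    intro A' hA' hc
    have : ∑ i ∈ A', (t + if t < y i then 1 else 0) ≤ ∑ i ∈ A', y i := by
      apply sum_le_sum
      intro i hi
      have := mem_sdiff.1 (hA' hi)
      have := hge i this.1 this.2
      split_ifs <;> omega
    rw [sum_add_distrib, sum_const, sum_boole, hc] at this
    simpa using this
  have hPQ : #P + #Q ≤ m - 1 := by
    by_cases hQm : m ≤ #Q
    · exfalso
      obtain ⟨A', h1, h2⟩ := exists_subset_card_eq hQm
      have h3 := hup A' (h1.trans (filter_subset _ _)) h2
      rw [filter_true_of_mem (fun i hi => (mem_filter.1 (h1 hi)).2), h2] at h3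
      have := h A hAB hAc A' (h1.trans ((filter_subset _ _).trans sdiff_subset)) h2
      omega
    · obtain ⟨A', h1, h2, h4⟩ := exists_subsuperset_card_eq (s := Q) (t := B \ A) (n := m)
        (filter_subset _ _) (by omega) (by omega)
      have h3 := hup A' h2 h4
      have h5 : #Q ≤ #(A'.filter fun i => t < y i) := by
        apply card_le_card
        intro i hi
        exact mem_filter.2 ⟨h1 hi, (mem_filter.1 hi).2⟩
      have := h A hAB hAc A' (h2.trans sdiff_subset) h4
      omega
  have hsub : B \ (P ∪ Q) ⊆ B.filter fun i => y i = t := by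
    intro i hi
    rw [mem_sdiff, mem_union, not_or] at hi
    obtain ⟨hiB, hiP, hiQ⟩ := hi
    refine mem_filter.2 ⟨hiB, ?_⟩
    by_cases hiA : i ∈ A
    · have := hmax i hiA
      have : ¬ y i < t := fun h => hiP (mem_filter.2 ⟨hiA, h⟩)
      omega
    · have := hge i hiB hiA
      have : ¬ t < y i := fun h => hiQ (mem_filter.2 ⟨mem_sdiff.2 ⟨hiB, hiA⟩, h⟩)
      omega
  have h1 := card_le_card hsub
  have h2 := card_union_le P Q
  have h3 := le_card_sdiff (P ∪ Q) B
  omega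

variable {G ι : Type*} [AddCommGroup G] [Fintype ι] [DecidableEq ι]
  {m n : ℕ} {x : ι → G} {H : AddSubgroup G}

theorem Ctx.pair (c : Ctx m n x H) (hn : 2 ≤ n) {J J' : Finset ι} {i j : ι}
    (hi : i ∈ J) (hi' : i ∉ J') (hj : j ∈ J') (hj' : j ∉ J)
    (hz : ∑ i ∈ J, x i ∈ H) (hz' : ∑ i ∈ J', x i ∈ H) (hK : #(J ∪ J') ≤ 2 * m) :
    ∑ i ∈ J, x i = ∑ i ∈ J', x i ∧ addOrderOf (∑ i ∈ J, x i) = n := by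
  have h1 : J ⊂ J ∪ J' := (ssubset_iff_of_subset subset_union_left).2
    ⟨j, mem_union_right _ hj, hj'⟩
  have h2 : J' ⊂ J ∪ J' := (ssubset_iff_of_subset subset_union_right).2
    ⟨i, mem_union_left _ hi, hi'⟩
  have h3 := c.good_sum hn (c.good_of_card hn hK) ⟨i, hi⟩ h1 hz
  exact ⟨(h3.2 J' ⟨j, hj⟩ h2 hz').symm, h3.1⟩

theorem zs_mem (hm : 2 ≤ m) {u v : G →+ ZMod m} (hfr : ∀ g, g ∈ H ↔ u g = 0 ∧ v g = 0)
    {I F : Finset ι} (hI : ∀ i ∈ I, v (x i) = 1) (hIc : #I = m)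
    (hF : ∀ i ∈ F, u (x i) = 1 ∧ v (x i) = 0) (hFc : #F = (-(u (∑ i ∈ I, x i))).val) :
    Disjoint I F ∧ ∑ i ∈ I ∪ F, x i = ∑ i ∈ I, x i + ∑ i ∈ F, x i ∧ ∑ i ∈ I ∪ F, x i ∈ H := by
  have : Fact (1 < m) := ⟨hm⟩
  have : NeZero m := ⟨by omega⟩
  have hd : Disjoint I F := by
    rw [disjoint_left]
    intro i h1 h2
    have := hI i h1
    rw [(hF i h2).2] at this
    exact zero_ne_one this
  refine ⟨hd, sum_union hd, ?_⟩
  rw [hfr, sum_union hd, map_add, map_add, map_sum v, map_sum v, sum_congr rfl hI,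
    map_sum u (fun i => x i) F, sum_congr rfl (fun i hi => (hF i hi).1),
    sum_congr rfl (fun i hi => (hF i hi).2)]
  simp [hIc, hFc]

/-- The case `m • h1 = 0`. -/
theorem Ctx.case_b (c : Ctx m n x H) {u : G →+ ZMod m} {q : ℕ} (hqn : q ≤ n) (hq1 : 1 ≤ q)
    (Bs : Finset ι) (hBc : #Bs = q * m) (h1 : G) (hu1 : u h1 = 1)
    (hx : ∀ i ∈ Bsᶜ, x i = h1) (hY : m • h1 = 0) : Concl m n (univ.val.map x) := by
  have hm := c.hm
  have hn := c.hn
  have hmn : m * 1 ≤ m * n := Nat.mul_le_mul_left _ hn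
  have hqm : 1 * m ≤ q * m := Nat.mul_le_mul_right _ hq1
  have : NeZero m := ⟨by omega⟩
  have : Finite G := Nat.finite_of_card_ne_zero (by
    rw [c.hG]; have := Nat.mul_pos (Nat.mul_pos (show 0 < m by omega) (show 0 < m by omega)) hn
    omega)
  have hqn' : q * m ≤ n * m := Nat.mul_le_mul_right _ hqn
  have hcomm : m * n = n * m := mul_comm _ _
  have hHsc : #Bsᶜ = m + m * n - 1 - q * m := by rw [card_compl, hBc, c.card]
  have hlt : #Bsᶜ < m := by
    by_contra hcon
    obtain ⟨J, hJ, hJc⟩ := exists_subset_card_eq (s := Bsᶜ) (n := m) (by omega)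
    refine c.min J (card_pos.1 (by omega)) ?_ ?_
    · rintro rfl
      have := card_le_card hJ
      rw [card_univ, c.card] at this
      omega
    · rw [sum_congr rfl (fun i hi => hx i (hJ hi)), sum_const, hJc, hY]
  have hqe : q = n := by
    by_contra hne
    have : (q + 1) * m ≤ n * m := Nat.mul_le_mul_right _ (by omega)
    rw [add_mul] at this
    omega
  subst hqe
  have hord : addOrderOf h1 = m := by
    apply Nat.dvd_antisymm (addOrderOf_dvd_of_nsmul_eq_zero hY)
    have h2 := congrArg u (addOrderOf_nsmul_eq_zero h1)
    rw [map_nsmul, hu1, map_zero, nsmul_eq_mul, mul_one] at h2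
    exact (ZMod.natCast_eq_zero_iff _ m).1 h2
  have hUB : (univ : Finset ι) \ Bsᶜ = Bs := by rw [← compl_eq_univ_sdiff, compl_compl]
  obtain ⟨q1, q2⟩ := quot_lemma x univ Bsᶜ (subset_univ _) h1 hx (by rw [hHsc, hord]; omega) (m * q)
    (by rw [hUB, hBc, mul_comm]) (by rw [hord, c.hG]; ring) c.sum0 (fun t _ h1 h2 => c.min t h1 h2)
  rw [hUB] at q1 q2
  obtain ⟨i1, hi1⟩ := card_pos.1 (show 0 < #Bs by omega)
  obtain ⟨hb1, hb2, hoe⟩ := basis_lemma h1 (x i1) (m * q) (by rw [hord, c.hG]; ring)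
    (q2 i1 hi1) (c.hexp _)
  left
  refine ⟨h1, x i1, h1, x i1, hb1, hoe, Or.inl rfl, ?_⟩
  apply form1 x c.sum0 Bsᶜ Bs (compl_compl _) h1 (x i1) (by rw [hHsc, hord]; omega)
    (by rw [hBc, hoe, mul_comm]) hx
  intro i hi
  exact q1 i hi i1 hi1

/-- The case `m • h1 ≠ 0`. -/
theorem Ctx.case_c (c : Ctx m n x H) (hn : 2 ≤ n) {u v : G →+ ZMod m}
    (hfr : ∀ g, g ∈ H ↔ u g = 0 ∧ v g = 0)
    {q : ℕ} (hqn : q ≤ n) (hq2 : 2 ≤ q)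
    (Bs : Finset ι) (hBv : ∀ i ∈ Bs, v (x i) = 1) (hBc : #Bs = q * m) (h1 : G) (hu1 : u h1 = 1)
    (hv1 : v h1 = 0) (hx : ∀ i ∈ Bsᶜ, x i = h1) (hY : m • h1 ≠ 0) :
    Concl m n (univ.val.map x) := by
  have hm := c.hm
  have : NeZero m := ⟨by omega⟩
  have hmn : m * 2 ≤ m * n := Nat.mul_le_mul_left _ hn
  have hqm : 2 * m ≤ q * m := Nat.mul_le_mul_right _ hq2
  have : Finite G := Nat.finite_of_card_ne_zero (by
    rw [c.hG]; have := Nat.mul_pos (Nat.mul_pos (show 0 < m by omega) (show 0 < m by omega)) c.hn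
    omega)
  have hqn' : q * m ≤ n * m := Nat.mul_le_mul_right _ hqn
  have hcomm : m * n = n * m := mul_comm _ _
  have hHsc : #Bsᶜ = (n + 1 - q) * m - 1 := by
    rw [card_compl, hBc, c.card, Nat.sub_mul, add_mul]; omega
  have hs1 : 1 * m ≤ (n + 1 - q) * m := Nat.mul_le_mul_right _ (by omega)
  have hHs : ∀ i ∈ Bsᶜ, u (x i) = 1 ∧ v (x i) = 0 := by
    intro i hi; rw [hx i hi]; exact ⟨hu1, hv1⟩
  obtain ⟨F0, hF0, hF0c⟩ := exists_subset_card_eq (s := Bsᶜ) (n := m - 1) (by omega)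
  set k : Finset ι → ℤ := fun I => ((-(u (∑ i ∈ I, x i))).val : ℤ) with hk
  have hk0 : ∀ I, 0 ≤ k I ∧ k I < m := by
    intro I
    have := ZMod.val_lt (-(u (∑ i ∈ I, x i)))
    simp only [hk]
    omega
  have hrel : ∀ I ⊆ Bs, #I = m → ∀ I' ⊆ Bs, #I' = m →
      ∑ i ∈ I, x i + k I • h1 = ∑ i ∈ I', x i + k I' • h1 := by
    apply swap_const Bs m (fun I => ∑ i ∈ I, x i + k I • h1)
    intro I hI hIc i hi j hj hjI
    set I' := insert j (I.erase i) with hI'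
    have hjI' : j ∉ I.erase i := fun h => hjI (mem_of_mem_erase h)
    have hI'c : #I' = m := by
      rw [hI', card_insert_of_notMem hjI', card_erase_of_mem hi]; omega
    have hI'B : I' ⊆ Bs := insert_subset hj ((erase_subset _ _).trans hI)
    obtain ⟨F1, hF1, hF1c⟩ := exists_subset_card_eq (s := F0) (n := (-(u (∑ i ∈ I, x i))).val) (by
      have := ZMod.val_lt (-(u (∑ i ∈ I, x i))); omega)
    obtain ⟨F2, hF2, hF2c⟩ := exists_subset_card_eq (s := F0) (n := (-(u (∑ i ∈ I', x i))).val) (by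
      have := ZMod.val_lt (-(u (∑ i ∈ I', x i))); omega)
    obtain ⟨-, s1, z1⟩ := zs_mem hm hfr (fun i hi => hBv i (hI hi)) hIc
      (fun i hi => hHs i (hF0 (hF1 hi))) hF1c
    obtain ⟨-, s2, z2⟩ := zs_mem hm hfr (fun i hi => hBv i (hI'B hi)) hI'c
      (fun i hi => hHs i (hF0 (hF2 hi))) hF2c
    have hnot : ∀ F ⊆ F0, ∀ b ∈ Bs, b ∉ F := fun F hF b hb hbF => mem_compl.1 (hF0 (hF hbF)) hb
    have hp := (c.pair hn (i := i) (j := j) (mem_union_left F1 hi)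
      (by
        rw [mem_union, not_or]
        refine ⟨?_, hnot F2 hF2 i (hI hi)⟩
        rw [mem_insert, not_or]
        exact ⟨fun h => hjI (h ▸ hi), by simp⟩)
      (mem_union_left F2 (mem_insert_self j _))
      (by rw [mem_union, not_or]; exact ⟨hjI, hnot F1 hF1 j hj⟩) z1 z2 (by
        have h3 : (I ∪ F1) ∪ (I' ∪ F2) ⊆ insert j I ∪ F0 := by
          refine union_subset (union_subset_union (subset_insert _ _) hF1)
            (union_subset_union ?_ hF2)
          exact insert_subset_insert _ (erase_subset _ _)
        have h4 := card_le_card h3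
        rw [hI'] at h4
        have h5 := card_union_le (insert j I) F0
        have h6 := card_insert_le j I
        omega)).1
    rw [s1, s2, sum_congr rfl (fun i hi => hx i (hF0 (hF1 hi))),
      sum_congr rfl (fun i hi => hx i (hF0 (hF2 hi))), sum_const, sum_const, hF1c, hF2c] at hp
    simp only [hk, natCast_zsmul]
    exact hp.symm
  obtain ⟨b0, y, hy1, -, hy3⟩ := int_lemma Bs x h1 k m m (by omega) (by omega)
    (fun I _ _ => hk0 I) (small_mult hm hu1 hY) hrel
  obtain ⟨t, ht⟩ := mode_lemma Bs y m (by omega) (by omega) (by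
    intro I hI hIc I' hI' hIc'
    have h2 := hy3 I hI hIc I' hI' hIc'
    have h3 := hk0 I
    have h4 := hk0 I'
    omega)
  set Z := Bs.filter fun i => y i = t with hZ
  set g2 := b0 + t • h1 with hg2
  have hZB : Z ⊆ Bs := filter_subset _ _
  have hZx : ∀ i ∈ Z, x i = g2 := by
    intro i hi
    rw [hy1 i (hZB hi), (mem_filter.1 hi).2]
  have hxB : ∀ i ∈ Bs, x i = -(t - y i) • h1 + g2 := by
    intro i hi
    rw [hy1 i hi, hg2, neg_smul, sub_smul]; abel
  obtain ⟨I0, hI0, hI0c⟩ := exists_subset_card_eq (s := Z) (n := m) (by omega)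
  have hsumI0 : ∑ i ∈ I0, x i = m • g2 := by
    rw [sum_congr rfl (fun i hi => hZx i (hI0 hi)), sum_const, hI0c]
  have hkI : ∀ I ⊆ Bs, #I = m → ∑ i ∈ I, (t - y i) = k I := by
    intro I hI hIc
    have h2 := hy3 I hI hIc I0 (hI0.trans hZB) hI0c
    have h3 : k I0 = 0 := by
      simp only [hk]
      rw [hsumI0, map_nsmul]
      simp
    rw [sum_congr rfl (fun i hi => (mem_filter.1 (hI0 hi)).2 : ∀ i ∈ I0, y i = t), sum_const, hI0c,
      h3] at h2
    rw [sum_sub_distrib, sum_const, hIc]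
    omega
  have hnn : ∀ i ∈ Bs, 0 ≤ t - y i := by
    intro i hi
    by_cases hiZ : i ∈ Z
    · have := (mem_filter.1 hiZ).2; omega
    obtain ⟨R, hR, hRc⟩ := exists_subset_card_eq (s := Z) (n := m - 1) (by omega)
    have hiR : i ∉ R := fun h => hiZ (hR h)
    have h2 := hkI (insert i R) (insert_subset hi (hR.trans hZB)) (by
      rw [card_insert_of_notMem hiR]; omega)
    rw [sum_insert hiR, sum_eq_zero (s := R) (fun i hi => by
      have := (mem_filter.1 (hR hi)).2; omega)] at h2
    have := (hk0 (insert i R)).1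
    omega
  have hNlt : #(Bs \ Z) < m := by
    by_contra hcon
    obtain ⟨I, hI, hIc⟩ := exists_subset_card_eq (s := Bs \ Z) (n := m) (by omega)
    have h2 := hkI I (hI.trans sdiff_subset) hIc
    have h3 : ∑ i ∈ I, (1:ℤ) ≤ ∑ i ∈ I, (t - y i) := by
      apply sum_le_sum
      intro i hi
      have h4 := mem_sdiff.1 (hI hi)
      have h5 := hnn i h4.1
      have h6 : y i ≠ t := fun h => h4.2 (mem_filter.2 ⟨h4.1, h⟩)
      omega
    have := (hk0 I).2
    rw [h2, sum_const, hIc, nsmul_eq_mul, mul_one] at h3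
    omega
  have hle : ∑ i ∈ Bs, (t - y i) ≤ m - 1 := by
    obtain ⟨I, g1, g2, g3⟩ := exists_subsuperset_card_eq (s := Bs \ Z) (t := Bs) (n := m)
      sdiff_subset (by omega) (by omega)
    rw [← sum_subset g2, hkI I g2 g3]
    · have := (hk0 I).2; omega
    · intro i hi hiI
      have : i ∈ Z := by
        by_contra h; exact hiI (g1 (mem_sdiff.2 ⟨hi, h⟩))
      have := (mem_filter.1 this).2
      omega
  have hsum : ∑ i ∈ Bs, (t - y i) = m - 1 := by
    have h2 := congrArg u (sum_add_sum_compl Bs x)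
    rw [c.sum0, sum_congr rfl hxB, sum_congr rfl hx, sum_add_distrib, ← sum_smul, sum_const,
      sum_const, sum_neg_distrib, hBc, hHsc, map_add, map_add, map_zsmul, map_nsmul, map_nsmul, hu1,
      map_zero, mul_smul, smul_comm q m] at h2
    simp only [zsmul_eq_mul, nsmul_eq_mul, CharP.cast_eq_zero, zero_mul, add_zero, mul_one] at h2
    rw [Nat.cast_sub (by omega), Nat.cast_mul] at h2
    simp only [CharP.cast_eq_zero, mul_zero, Nat.cast_one, zero_sub] at h2
    have h3 : ((∑ i ∈ Bs, (t - y i) + 1 : ℤ) : ZMod m) = 0 := by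
      rw [Int.cast_add, Int.cast_one]
      rw [Int.cast_neg] at h2
      linear_combination -h2
    have h4 := (ZMod.intCast_zmod_eq_zero_iff_dvd _ m).1 h3
    have h5 := sum_nonneg hnn
    have := Int.le_of_dvd (by omega) h4
    omega
  have hz0 : ∑ i ∈ I0, x i ∈ H := by
    rw [hfr, map_sum v, sum_congr rfl (fun i hi => hBv i (hZB (hI0 hi))), hsumI0]
    simp [hI0c]
  obtain ⟨e, he, heI⟩ := exists_mem_notMem_of_card_lt_card (s := I0) (t := Z) (by omega)
  have hvg : v g2 = 1 := by rw [← hZx e he]; exact hBv e (hZB he)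
  have hordm : addOrderOf (m • g2) = n := by
    rw [← hsumI0]
    exact (c.good_sum hn (c.good_of_card hn (K := insert e I0) (by
      have := card_insert_le e I0; omega)) (card_pos.1 (by omega)) (ssubset_insert heI) hz0).1
  have hord : addOrderOf g2 = m * n := by
    have h2 := congrArg v (addOrderOf_nsmul_eq_zero g2)
    rw [map_nsmul, hvg, map_zero, nsmul_eq_mul, mul_one] at h2
    have h3 := (ZMod.natCast_eq_zero_iff _ m).1 h2
    rw [addOrderOf_nsmul_of_dvd (by omega) h3] at hordm
    rw [← hordm, Nat.mul_div_cancel' h3]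
  have hHz : AddSubgroup.zmultiples (m • g2) = H := by
    apply AddSubgroup.eq_of_le_of_card_ge
    · rw [AddSubgroup.zmultiples_le, ← hsumI0]; exact hz0
    · rw [Nat.card_zmultiples, hordm, c.hH]
  right
  refine ⟨n + 1 - q, by omega, by omega, h1, g2, ?_, hord, ?_, ?_⟩
  · rw [eq_top_iff]
    intro g _
    have hm1 : h1 ∈ AddSubgroup.closure {h1, g2} := AddSubgroup.subset_closure (by simp)
    have hm2 : g2 ∈ AddSubgroup.closure {h1, g2} := AddSubgroup.subset_closure (by simp)
    have h2 : g - (v g).val • g2 - (u g - v g * u g2).val • h1 ∈ H := by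
      rw [hfr]
      simp [hu1, hv1, hvg]
    rw [← hHz] at h2
    obtain ⟨l, hl⟩ := AddSubgroup.mem_zmultiples_iff.1 h2
    have : g = l • (m • g2) + (u g - v g * u g2).val • h1 + (v g).val • g2 := by rw [hl]; abel
    rw [this]
    exact add_mem (add_mem (zsmul_mem (nsmul_mem hm2 _) _) (nsmul_mem hm1 _)) (nsmul_mem hm2 _)
  · intro hs
    have hs2 : 2 * m ≤ (n + 1 - q) * m := Nat.mul_le_mul_right _ (by omega)
    obtain ⟨J0, hJ0, hJ0c⟩ := exists_subset_card_eq (s := Bsᶜ) (n := m) (by omega)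
    have hsJ : ∑ i ∈ J0, x i = m • h1 := by
      rw [sum_congr rfl (fun i hi => hx i (hJ0 hi)), sum_const, hJ0c]
    obtain ⟨i, hi⟩ := card_pos.1 (show 0 < #J0 by omega)
    obtain ⟨j, hj⟩ := card_pos.1 (show 0 < #I0 by omega)
    rw [← hsJ, ← hsumI0]
    refine (c.pair hn hi (fun h => mem_compl.1 (hJ0 hi) (hZB (hI0 h))) hj
      (fun h => mem_compl.1 (hJ0 h) (hZB (hI0 hj))) ?_ hz0 ?_).1
    · rw [hsJ, hfr]; simp
    · have := card_union_le J0 I0; omega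
  · obtain ⟨xx, e1, e2⟩ := to_form x Bsᶜ Bs (compl_compl _) ((n + 1 - q) * m - 1)
      ((n + 1 - (n + 1 - q)) * m) hHsc
      (by rw [hBc]; congr 1; omega) h1 g2 hx (fun i => (t - y i).toNat) (by
        intro i hi
        rw [Int.toNat_of_nonneg (hnn i hi)]; exact hxB i hi)
    refine ⟨xx, ?_, e2⟩
    rw [e1]
    have : ((∑ i ∈ Bs, (t - y i).toNat : ℕ) : ℤ) = m - 1 := by
      rw [← hsum]; push_cast
      exact sum_congr rfl (fun i hi => by have := hnn i hi; omega)
    omega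

end


section
open Finset

theorem four_lemma {m : ℕ} (hm : 3 ≤ m) (ρ a b c d : ZMod m) (hab : a ≠ b) (hcd : c ≠ d)
    (h1 : ρ + (a + c) = 0 ∨ ρ + (a + c) = 1) (h2 : ρ + (a + d) = 0 ∨ ρ + (a + d) = 1)
    (h3 : ρ + (b + c) = 0 ∨ ρ + (b + c) = 1) (h4 : ρ + (b + d) = 0 ∨ ρ + (b + d) = 1) : False := by
  have htwo : (2 : ZMod m) ≠ 0 := by
    intro h
    have : ((2 : ℕ) : ZMod m) = 0 := by exact_mod_cast h
    have := Nat.le_of_dvd (by omega) ((ZMod.natCast_eq_zero_iff _ m).1 this)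
    omega
  have hone : (1 : ZMod m) ≠ 0 := by
    intro h
    have : ((1 : ℕ) : ZMod m) = 0 := by exact_mod_cast h
    have := Nat.le_of_dvd (by omega) ((ZMod.natCast_eq_zero_iff _ m).1 this)
    omega
  rcases h1 with h1 | h1
  · have e2 : ρ + (a + d) = 1 := h2.resolve_left (fun h => hcd (by linear_combination h1 - h))
    have e3 : ρ + (b + c) = 1 := h3.resolve_left (fun h => hab (by linear_combination h1 - h))
    rcases h4 with h4 | h4
    · exact htwo (by linear_combination h4 + h1 - e2 - e3)
    · exact hone (by linear_combination h4 + h1 - e2 - e3)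
  · have e2 : ρ + (a + d) = 0 := h2.resolve_right (fun h => hcd (by linear_combination h1 - h))
    have e3 : ρ + (b + c) = 0 := h3.resolve_right (fun h => hab (by linear_combination h1 - h))
    rcases h4 with h4 | h4
    · exact hone (by linear_combination -h4 - h1 + e2 + e3)
    · exact htwo (by linear_combination -h4 - h1 + e2 + e3)

theorem almost_const {ι : Type*} [DecidableEq ι] {m : ℕ} (hm : 3 ≤ m) (B : Finset ι)
    (hB : 2 * m ≤ #B) (w : ι → ZMod m)
    (h : ∀ I ⊆ B, #I = m → ∑ i ∈ I, w i = 0 ∨ ∑ i ∈ I, w i = 1) :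
    ∃ j ∈ B, ∃ a, ∀ i ∈ B, i ≠ j → w i = a := by
  have key : ∀ i ∈ B, ∀ j ∈ B, w i ≠ w j → ∀ k ∈ B, ∀ l ∈ B, k ≠ i → k ≠ j → l ≠ i → l ≠ j →
      w k = w l := by
    intro i hi j hj hij k hk l hl hki hkj hli hlj
    by_contra hkl
    have hc : #({i, j, k, l} : Finset ι) ≤ 4 := card_le_four
    obtain ⟨R, hR, hRc⟩ := exists_subset_card_eq (s := B \ {i, j, k, l}) (n := m - 2) (by
      have := le_card_sdiff ({i, j, k, l} : Finset ι) B
      omega)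
    have hn : ∀ a ∈ ({i, j, k, l} : Finset ι), a ∉ R := fun a ha haR => (mem_sdiff.1 (hR haR)).2 ha
    have hg : ∀ a ∈ B, ∀ b ∈ B, a ∉ R → b ∉ R → a ≠ b →
        ∑ i ∈ R, w i + (w a + w b) = 0 ∨ ∑ i ∈ R, w i + (w a + w b) = 1 := by
      intro a ha b hb haR hbR hab
      have h1 : a ∉ insert b R := by simp [hab, haR]
      have := h (insert a (insert b R)) (insert_subset ha (insert_subset hb (hR.trans sdiff_subset)))
        (by rw [card_insert_of_notMem h1, card_insert_of_notMem hbR]; omega)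
      rw [sum_insert h1, sum_insert hbR] at this
      have e : ∑ i ∈ R, w i + (w a + w b) = w a + (w b + ∑ i ∈ R, w i) := by ring
      rw [e]; exact this
    have ni := hn i (by simp)
    have nj := hn j (by simp)
    have nk := hn k (by simp)
    have nl := hn l (by simp)
    exact four_lemma hm _ _ _ _ _ hij hkl (hg i hi k hk ni nk hki.symm)
      (hg i hi l hl ni nl hli.symm) (hg j hj k hk nj nk hkj.symm) (hg j hj l hl nj nl hlj.symm)
  by_cases hall : ∃ i ∈ B, ∃ j ∈ B, w i ≠ w j
  · obtain ⟨i, hi, j, hj, hij⟩ := hall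
    have hij' : i ≠ j := fun h => hij (by rw [h])
    obtain ⟨R, hR, hRc⟩ := exists_subset_card_eq (s := (B.erase i).erase j) (n := 2) (by
      rw [card_erase_of_mem (mem_erase.2 ⟨hij'.symm, hj⟩), card_erase_of_mem hi]; omega)
    obtain ⟨r, r', hrr, rfl⟩ := card_eq_two.1 hRc
    have hr := hR (show r ∈ ({r, r'} : Finset ι) by simp)
    have hr' := hR (show r' ∈ ({r, r'} : Finset ι) by simp)
    simp only [mem_erase] at hr hr'
    have hcst : ∀ k ∈ B, k ≠ i → k ≠ j → w k = w r := fun k hk h1 h2 =>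
      key i hi j hj hij k hk r hr.2.2 h1 h2 hr.2.1 hr.1
    by_cases hi' : w i = w r
    · refine ⟨j, hj, w r, fun k hk hkj => ?_⟩
      by_cases hki : k = i
      · rw [hki, hi']
      · exact hcst k hk hki hkj
    · refine ⟨i, hi, w r, fun k hk hki => ?_⟩
      by_cases hkj : k = j
      · have e1 := hcst r' hr'.2.2 hr'.2.1 hr'.1
        have := key i hi r hr.2.2 hi' j hj r' hr'.2.2 hij'.symm (Ne.symm hr.1) hr'.2.1 hrr.symm
        rw [hkj, this, e1]
      · exact hcst k hk hki hkj
  · push Not at hall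
    obtain ⟨j, hj⟩ := card_pos.1 (show 0 < #B by omega)
    exact ⟨j, hj, w j, fun i hi _ => hall i hi j hj⟩

variable {G ι : Type*} [AddCommGroup G] [Fintype ι] [DecidableEq ι]
  {m n : ℕ} {x : ι → G} {H : AddSubgroup G}

theorem Ctx.case_a (c : Ctx m n x H) (hn : 2 ≤ n) {u v : G →+ ZMod m}
    (hfr : ∀ g, g ∈ H ↔ u g = 0 ∧ v g = 0)
    (Bs : Finset ι) (hBv : ∀ i ∈ Bs, v (x i) = 1) (hBc : #Bs = n * m)
    (hHs : ∀ i ∈ Bsᶜ, u (x i) = 1 ∧ v (x i) = 0) :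
    (∀ i ∈ Bsᶜ, ∀ j ∈ Bsᶜ, x i = x j) ∨ Concl m n (univ.val.map x) := by
  have hm := c.hm
  have : NeZero m := ⟨by omega⟩
  have : Fact (1 < m) := ⟨hm⟩
  have hmn : 2 * m ≤ n * m := Nat.mul_le_mul_right _ hn
  have hcomm : m * n = n * m := mul_comm _ _
  have hHsc : #Bsᶜ = m - 1 := by
    rw [card_compl, hBc, c.card]; omega
  rcases Nat.lt_or_ge m 3 with hm3 | hm3
  · left
    intro i hi j hj
    rw [card_le_one.1 (show #Bsᶜ ≤ 1 by omega) i hi j hj]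
  by_cases hex : ∃ I ⊆ Bs, #I = m ∧ 1 ≤ (-(u (∑ i ∈ I, x i))).val ∧
      (-(u (∑ i ∈ I, x i))).val ≤ m - 2
  · left
    obtain ⟨I, hI, hIc, hk1, hk2⟩ := hex
    intro i hi j hj
    by_cases hij : i = j
    · rw [hij]
    obtain ⟨R, hR, hRc⟩ := exists_subset_card_eq (s := (Bsᶜ.erase i).erase j)
      (n := (-(u (∑ i ∈ I, x i))).val - 1) (by
      rw [card_erase_of_mem (mem_erase.2 ⟨Ne.symm hij, hj⟩), card_erase_of_mem hi]; omega)
    have hiR : i ∉ R := fun h => by simpa using hR h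
    have hjR : j ∉ R := fun h => by simpa using hR h
    have hRB : R ⊆ Bsᶜ := fun a ha => mem_of_mem_erase (mem_of_mem_erase (hR ha))
    have hiI : i ∉ I := fun h => mem_compl.1 hi (hI h)
    have hjI : j ∉ I := fun h => mem_compl.1 hj (hI h)
    have hsi := insert_subset hi hRB
    have hsj := insert_subset hj hRB
    obtain ⟨-, s1, z1⟩ := zs_mem hm hfr (F := insert i R) (fun i hi => hBv i (hI hi)) hIc
      (fun i hi => hHs i (hsi hi)) (by rw [card_insert_of_notMem hiR]; omega)
    obtain ⟨-, s2, z2⟩ := zs_mem hm hfr (F := insert j R) (fun i hi => hBv i (hI hi)) hIc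
      (fun i hi => hHs i (hsj hi)) (by rw [card_insert_of_notMem hjR]; omega)
    have hp := (c.pair hn (i := i) (j := j) (J := I ∪ insert i R) (J' := I ∪ insert j R)
      (by simp) (by simp [hiI, hiR, hij]) (by simp) (by simp [hjI, hjR, Ne.symm hij]) z1 z2 (by
        have h3 : (I ∪ insert i R) ∪ (I ∪ insert j R) ⊆ I ∪ Bsᶜ :=
          union_subset (union_subset_union Subset.rfl hsi) (union_subset_union Subset.rfl hsj)
        have h4 := card_le_card h3
        have h5 := card_union_le I Bsᶜ
        omega)).1
    rw [s1, s2, sum_insert hiR, sum_insert hjR] at hp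
    exact add_right_cancel (add_left_cancel hp)
  · right
    push Not at hex
    obtain ⟨j0, hj0, a, ha⟩ := almost_const hm3 Bs (by omega) (fun i => u (x i)) (by
      intro I hI hIc
      have h1 := hex I hI hIc
      rw [map_sum] at h1
      set U := ∑ i ∈ I, u (x i) with hU
      have h2 := ZMod.val_lt (-U)
      rcases Nat.eq_zero_or_pos (-U).val with h3 | h3
      · left
        rw [ZMod.val_eq_zero] at h3
        exact neg_eq_zero.1 h3
      · right
        have h4 := h1 h3
        have h5 : (-U).val = m - 1 := by omega
        have h6 := ZMod.natCast_zmod_val (-U)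
        rw [h5, Nat.cast_sub (by omega)] at h6
        simp at h6
        exact h6.symm)
    have hj0u : u (x j0) = a + 1 := by
      have h2 := congrArg u (sum_add_sum_compl Bs x)
      rw [c.sum0, map_add, map_sum, map_sum, map_zero, sum_congr rfl (fun i hi => (hHs i hi).1),
        ← add_sum_erase Bs _ hj0,
        sum_congr rfl (fun i hi => ha i (mem_of_mem_erase hi) (ne_of_mem_erase hi)), sum_const,
        sum_const, card_erase_of_mem hj0, hHsc, hBc, nsmul_eq_mul, nsmul_eq_mul,
        Nat.cast_sub (by omega), Nat.cast_sub (by omega), Nat.cast_mul] at h2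
      simp only [CharP.cast_eq_zero, mul_zero, Nat.cast_one] at h2
      linear_combination h2
    have hw : ∀ g, (u - (AddMonoidHom.mulLeft a).comp v) g = u g - a * v g := fun g => by simp
    have hwB : ∀ i ∈ Bs, i ≠ j0 → (u - (AddMonoidHom.mulLeft a).comp v) (x i) = 0 := by
      intro i hi hij
      rw [hw, hBv i hi, ha i hi hij]; ring
    have hwj : (u - (AddMonoidHom.mulLeft a).comp v) (x j0) = 1 := by
      rw [hw, hBv j0 hj0, hj0u]; ring
    have hwH : ∀ i ∈ Bsᶜ, (u - (AddMonoidHom.mulLeft a).comp v) (x i) = 1 := by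
      intro i hi
      rw [hw, (hHs i hi).1, (hHs i hi).2]; ring
    apply c.case1 (u := v) (v := u - (AddMonoidHom.mulLeft a).comp v)
    · intro g
      rw [hfr, hw]
      constructor
      · rintro ⟨h1, h2⟩; simp [h1, h2]
      · rintro ⟨h1, h2⟩; simp [h1] at h2; exact ⟨h2, h1⟩
    · intro i
      by_cases hi : i ∈ Bs
      · by_cases hij : i = j0
        · left; rw [hij]; exact hwj
        · exact Or.inr ⟨hBv i hi, hwB i hi hij⟩
      · exact Or.inl (hwH i (mem_compl.2 hi))
    · have : (univ.filter fun i => (u - (AddMonoidHom.mulLeft a).comp v) (x i) = 1)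
          = insert j0 Bsᶜ := by
        ext i
        rw [mem_filter, mem_insert]
        constructor
        · rintro ⟨-, h⟩
          by_contra hcon
          push Not at hcon
          rw [mem_compl, not_not] at hcon
          rw [hwB i hcon.2 hcon.1] at h
          exact zero_ne_one h
        · rintro (rfl | h)
          · exact ⟨mem_univ _, hwj⟩
          · exact ⟨mem_univ _, hwH i h⟩
      rw [this, card_insert_of_notMem (by simpa using hj0), hHsc]
      omega

theorem Ctx.main (c : Ctx m n x H) (hB : PropertyB m) : Concl m n (univ.val.map x) := by
  have hm := c.hm
  have : NeZero m := ⟨by omega⟩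
  obtain ⟨u, v, hfr, hd, q, hq1, hqn, hqc⟩ := c.good_frame hB
  rcases Nat.lt_or_ge q 2 with hq | hq
  · exact c.case1 hfr hd (by rw [hqc]; have : q = 1 := by omega
                             rw [this, one_mul])
  have hn : 2 ≤ n := by omega
  set Bs := univ.filter fun i => v (x i) = 1 with hBs
  have hBv : ∀ i ∈ Bs, v (x i) = 1 := fun i hi => (mem_filter.1 hi).2
  have hHs : ∀ i ∈ Bsᶜ, u (x i) = 1 ∧ v (x i) = 0 := by
    intro i hi
    rcases hd i with h | h
    · exfalso; simp [hBs] at hi; exact hi h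
    · exact h
  have hqn' : q * m ≤ n * m := Nat.mul_le_mul_right _ hqn
  have hcomm : m * n = n * m := mul_comm _ _
  have hHsc : #Bsᶜ = m + m * n - 1 - q * m := by rw [card_compl, hqc, c.card]
  have hconst : (∀ i ∈ Bsᶜ, ∀ j ∈ Bsᶜ, x i = x j) ∨ Concl m n (univ.val.map x) := by
    by_cases hqe : q = n
    · subst hqe
      exact c.case_a hn hfr Bs hBv hqc hHs
    · left
      apply c.constHs hn hfr Bsᶜ hHs
      have : (q + 1) * m ≤ n * m := Nat.mul_le_mul_right _ (by omega)
      rw [add_mul] at this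
      omega
  rcases hconst with hconst | h
  swap
  · exact h
  obtain ⟨i0, hi0⟩ := card_pos.1 (show 0 < #Bsᶜ by omega)
  have hx : ∀ i ∈ Bsᶜ, x i = x i0 := fun i hi => hconst i hi i0 hi0
  obtain ⟨hu1, hv1⟩ := hHs i0 hi0
  by_cases hY : m • x i0 = 0
  · exact c.case_b hqn (by omega) Bs hqc (x i0) hu1 hx hY
  · exact c.case_c hn hfr hqn hq Bs hBv hqc (x i0) hu1 hv1 hx hY

end

theorem stmt_14 (m n : ℕ) (hm : 2 ≤ m) (hn : 1 ≤ n)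
    (G : Type*) [AddCommGroup G] (hG : Nonempty (G ≃+ ZMod m × ZMod (m * n)))
    (hB : PropertyB m)
    (S : Multiset G) (hS : IsMinZeroSumSeq S) (hcard : S.card = m + m * n - 1) :
    (∃ e1 e2 ej ek : G, IsBasisPair e1 e2 ∧ addOrderOf e2 = m * n ∧
      ((ej, ek) = (e1, e2) ∨ (ej, ek) = (e2, e1)) ∧
      ∃ x : Fin (addOrderOf ek) → ℕ,
        ((∑ i, (x i : ℤ)) ≡ -1 [ZMOD (addOrderOf ej)]) ∧
        S = Multiset.replicate (addOrderOf ej - 1) ej +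
          Multiset.map (fun i => -(x i : ℤ) • ej + ek) Finset.univ.val) ∨
    (∃ s : ℕ, 1 ≤ s ∧ s ≤ n ∧ ∃ g1 g2 : G,
      AddSubgroup.closure {g1, g2} = ⊤ ∧ addOrderOf g2 = m * n ∧
      (s ≠ 1 → m • g1 = m • g2) ∧
      ∃ x : Fin ((n + 1 - s) * m) → ℕ, (∑ i, x i) = m - 1 ∧
        S = Multiset.replicate (s * m - 1) g1 +
          Multiset.map (fun i => -(x i : ℤ) • g1 + g2) Finset.univ.val) := by
  change Concl m n S
  obtain ⟨f⟩ := hG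
  have hm0 : NeZero m := ⟨by omega⟩
  have hmn0 : NeZero (m * n) := ⟨by have := Nat.mul_pos (show 0 < m by omega) hn; omega⟩
  let x : Fin S.toList.length → G := fun i => S.toList.get i
  have hxS : (Finset.univ : Finset (Fin S.toList.length)).val.map x = S := by
    have h1 : (Finset.univ : Finset (Fin S.toList.length)).val.map x
        = ((List.ofFn x : List G) : Multiset G) := by
      rw [← Fin.univ_val_map]
    rw [h1, List.ofFn_get, Multiset.coe_toList]
  let u : G →+ ZMod m := (AddMonoidHom.fst (ZMod m) (ZMod (m * n))).comp f.toAddMonoidHom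
  let v : G →+ ZMod m := ((ZMod.castHom (dvd_mul_right m n) (ZMod m)).toAddMonoidHom.comp
    (AddMonoidHom.snd (ZMod m) (ZMod (m * n)))).comp f.toAddMonoidHom
  have hcG : Nat.card G = m * m * n := by
    rw [Nat.card_congr f.toEquiv, Nat.card_prod, Nat.card_zmod, Nat.card_zmod, mul_assoc]
  have hsurj : Function.Surjective (u.prod v) := by
    rintro ⟨a, b⟩
    obtain ⟨b', hb'⟩ := ZMod.castHom_surjective (dvd_mul_right m n) b
    refine ⟨f.symm (a, b'), ?_⟩
    ext
    · simp [u]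
    · simpa [v] using hb'
  have hcH : Nat.card (u.prod v).ker = n := by
    have h1 := AddSubgroup.card_eq_card_quotient_mul_card_addSubgroup (u.prod v).ker
    rw [Nat.card_congr (QuotientAddGroup.quotientKerEquivOfSurjective _ hsurj).toEquiv, hcG,
      Nat.card_prod, Nat.card_zmod] at h1
    exact (Nat.eq_of_mul_eq_mul_left (Nat.mul_pos (by omega) (by omega)) h1).symm
  have c : Ctx m n x (u.prod v).ker := by
    refine ⟨hm, hn, ?_, ?_, ?_, hcH, hcG, ?_, u, v, ?_⟩
    · rw [Fintype.card_fin, Multiset.length_toList, hcard]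
    · rw [Finset.sum, hxS]; exact hS.2.1
    · intro J hJ hJu
      have h1 : J.val.map x ≤ S := by
        conv_rhs => rw [← hxS]
        exact Multiset.map_le_map (Finset.val_le_iff.2 (Finset.subset_univ J))
      refine hS.2.2 (J.val.map x) h1 ?_ ?_
      · intro h
        rw [Multiset.map_eq_zero, Finset.val_eq_zero] at h
        exact hJ.ne_empty h
      · intro h
        have := congrArg Multiset.card h
        rw [Multiset.card_map, ← Multiset.length_toList S] at this
        apply hJu
        rw [← Finset.card_eq_iff_eq_univ, Fintype.card_fin]
        exact this
    · intro g
      apply f.injective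
      rw [map_nsmul, map_zero]
      ext
      · simp
      · simp
        rw [← Nat.cast_mul]; simp
    · intro g
      rw [AddMonoidHom.mem_ker, AddMonoidHom.prod_apply, Prod.mk_eq_zero]
  rw [← hxS]
  exact c.main hB
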